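/- arXiv:2401.12661 — 8 statements merged into one kernel-verified Lean document; each statement's English description precedes it below -/
import Mathlib

section
/- Fix an integer G ≥ 1 and positive reals k_on, k_off, k_1, …, k_G, and let φ(s) = [k_1 (s + k_on) / (s² + s(k_1 + k_on + k_off) + k_1 k_on)] · ∏_{i=2}^G k_i/(s + k_i) and α = (k_on + k_off)/(k_on k_1) + Σ_{i=2}^G 1/k_i. Let f : [0,∞) → ℝ be a nonnegative integrable function with ∫_0^∞ f(t) dt = 1 and ∫_0^∞ f(t) e^{−st} dt = φ(s) for all s > 0. Define iterated convolutions f^{*1} = f and f^{*(n+1)}(x) = ∫_0^x f^{*n}(x−u) f(u) du, set F_n(x) = ∫_0^x f^{*n}(u) du, and let the renewal function be R(x) = Σ_{n=1}^∞ F_n(x). Suppose p and q are coprime complex polynomials with φ(s)/(s(1 − φ(s))) = p(s)/q(s), where q(s) = s² ∏_{r=1}^M (s + s_r) for pairwise distinct nonzero complex numbers s_1, …, s_M with positive real part. Then for every x ≥ 0, R(x) = x/α − Σ_{r=1}^M A_r (1 − e^{−s_r x}), where A_r = p(−s_r)/q'(−s_r). -/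
open Complex Polynomial MeasureTheory Set

/-- Iterated convolutions of a density supported on `[0,∞)`:
`convIter f n = f^{*(n+1)}`, i.e. `convIter f 0 = f` and
`f^{*(n+1)}(x) = ∫_0^x f^{*n}(x−u) f(u) du`. -/
noncomputable def convIter (f : ℝ → ℝ) : ℕ → ℝ → ℝ
  | 0 => f
  | n + 1 => fun x => ∫ u in (0 : ℝ)..x, convIter f n (x - u) * f u

lemma ren_unique (H : ℝ → ℂ) (hi : IntegrableOn H (Ioi 0)) (hc : ContinuousOn H (Ioi 0))
    (hz : ∀ n : ℕ, ∫ x in Ioi (0:ℝ), ((Real.exp (-x)) ^ n) • H x = 0) :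
    ∀ x : ℝ, 0 < x → H x = 0 := by
  have hint : ∀ n : ℕ, IntegrableOn (fun x => ((Real.exp (-x)) ^ n) • H x) (Ioi 0) := by
    intro n
    refine Integrable.mono hi ?_ ?_
    · exact (by fun_prop : Continuous fun x : ℝ => (Real.exp (-x)) ^ n).aestronglyMeasurable.smul
        hi.aestronglyMeasurable
    · filter_upwards [ae_restrict_mem measurableSet_Ioi] with x hx
      rw [norm_smul]
      have h1 : ‖Real.exp (-x) ^ n‖ ≤ 1 := by
        rw [Real.norm_of_nonneg (by positivity)]
        apply pow_le_one₀ (by positivity)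
        rw [Real.exp_le_one_iff]
        have : 0 < x := hx
        linarith
      nlinarith [norm_nonneg (H x)]
  have hP : ∀ P : ℝ[X], IntegrableOn (fun x => (P.eval (Real.exp (-x))) • H x) (Ioi 0) ∧
      ∫ x in Ioi (0:ℝ), (P.eval (Real.exp (-x))) • H x = 0 := by
    intro P
    simp only [Polynomial.eval_eq_sum_range, Finset.sum_smul, mul_smul]
    constructor
    · exact integrable_finsetSum _ fun i _ => (hint i).smul (P.coeff i)
    · rw [integral_finsetSum (Finset.range (P.natDegree + 1))
        (f := fun i x => P.coeff i • Real.exp (-x) ^ i • H x) fun i _ => (hint i).smul (P.coeff i)]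
      apply Finset.sum_eq_zero
      intro i _
      rw [integral_smul, hz, smul_zero]
  have hae : ∀ᵐ x ∂(volume : Measure ℝ), x ∈ Ioi (0:ℝ) → H x = 0 := by
    apply isOpen_Ioi.ae_eq_zero_of_integral_contDiff_smul_eq_zero hi.locallyIntegrableOn
    intro g gd gs gt
    have g0 : ∀ x, x ≤ 0 → g x = 0 := by
      intro x hx
      by_contra hne
      have := gt (subset_tsupport g hne)
      exact absurd this (not_lt.mpr hx)
    have hcont : ContinuousOn (fun y => g (-Real.log y)) (Icc 0 1) := by
      intro y hy
      apply ContinuousAt.continuousWithinAt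
      rcases eq_or_ne y 0 with rfl | hy0
      · have h2 : Filter.Tendsto (fun y => g (-Real.log y)) (nhdsWithin 0 {0}ᶜ) (nhds 0) := by
          have h3 : Filter.Tendsto g Filter.atTop (nhds 0) := by
            exact (gs.is_zero_at_infty).mono_left atTop_le_cocompact
          exact h3.comp (Filter.tendsto_neg_atBot_atTop.comp Real.tendsto_log_nhdsNE_zero)
        rw [continuousAt_iff_punctured_nhds]
        simpa [g0 0 le_rfl] using h2
      · exact gd.continuous.continuousAt.comp (Real.continuousAt_log hy0).neg
    have hgint : IntegrableOn (fun x => g x • H x) (Ioi 0) := by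
      obtain ⟨C, hC⟩ := gs.exists_bound_of_continuous gd.continuous
      exact hi.bdd_smul C gd.continuous.aestronglyMeasurable (ae_of_all _ hC)
    have hres : ∫ x, g x • H x = ∫ x in Ioi (0:ℝ), g x • H x := by
      rw [setIntegral_eq_integral_of_forall_compl_eq_zero]
      intro x hx
      rw [g0 x (not_lt.mp hx), zero_smul]
    rw [hres]
    rw [← norm_eq_zero]
    apply le_antisymm _ (norm_nonneg _)
    have hb : ∀ ε : ℝ, 0 < ε → ‖∫ x in Ioi (0:ℝ), g x • H x‖ ≤ ε * ∫ x in Ioi (0:ℝ), ‖H x‖ := by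
      intro ε hε
      obtain ⟨P, hPn⟩ := exists_polynomial_near_of_continuousOn 0 1 _ hcont ε hε
      have : ∫ x in Ioi (0:ℝ), g x • H x =
          ∫ x in Ioi (0:ℝ), (g x • H x - (P.eval (Real.exp (-x))) • H x) := by
        rw [integral_sub hgint (hP P).1, (hP P).2, sub_zero]
      rw [this, ← integral_const_mul]
      apply norm_integral_le_of_norm_le (hi.norm.const_mul ε)
      filter_upwards [ae_restrict_mem measurableSet_Ioi] with x hx
      have hx : 0 < x := hx
      rw [← sub_smul, norm_smul]
      gcongr
      have := hPn (Real.exp (-x)) ⟨(Real.exp_pos _).le, by rw [Real.exp_le_one_iff]; linarith⟩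
      simp only [Real.log_exp, neg_neg] at this
      rw [Real.norm_eq_abs, abs_sub_comm]
      exact this.le
    have hI : 0 ≤ ∫ x in Ioi (0:ℝ), ‖H x‖ := integral_nonneg fun _ => norm_nonneg _
    apply le_of_forall_pos_le_add
    intro ε hε
    have := hb (ε / ((∫ x in Ioi (0:ℝ), ‖H x‖) + 1)) (by positivity)
    refine this.trans ?_
    rw [zero_add, div_mul_eq_mul_div, div_le_iff₀ (by positivity)]
    nlinarith
  have hEq : EqOn H 0 (Ioi 0) := by
    apply MeasureTheory.Measure.eqOn_open_of_ae_eq (μ := (volume : Measure ℝ)) _ isOpen_Ioi hc continuousOn_const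
    rw [Filter.EventuallyEq, ae_restrict_iff' measurableSet_Ioi]
    exact hae
  exact fun x hx => hEq hx

lemma ren_conv (a b : ℝ → ℝ) (s : ℝ)
    (ha : IntegrableOn (fun t => a t * Real.exp (-(s * t))) (Ioi 0))
    (hb : IntegrableOn (fun t => b t * Real.exp (-(s * t))) (Ioi 0)) :
    IntegrableOn (fun x => (∫ u in (0:ℝ)..x, b (x - u) * a u) * Real.exp (-(s * x))) (Ioi 0) ∧
    ∫ x in Ioi (0:ℝ), (∫ u in (0:ℝ)..x, b (x - u) * a u) * Real.exp (-(s * x)) =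
      (∫ x in Ioi (0:ℝ), a x * Real.exp (-(s * x))) *
      (∫ x in Ioi (0:ℝ), b x * Real.exp (-(s * x))) := by
  have key : ∀ x, (∫ u in (0:ℝ)..x, b (x - u) * a u) * Real.exp (-(s * x)) =
      ∫ u in (0:ℝ)..x, ContinuousLinearMap.mul ℝ ℝ (a u * Real.exp (-(s * u)))
        (b (x - u) * Real.exp (-(s * (x - u)))) := by
    intro x
    rw [← intervalIntegral.integral_mul_const]
    congr 1
    ext u
    simp only [ContinuousLinearMap.mul_apply']
    have : Real.exp (-(s * x)) = Real.exp (-(s * u)) * Real.exp (-(s * (x - u))) := by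
      rw [← Real.exp_add]; ring_nf
    rw [this]; ring
  constructor
  · have := integrable_posConvolution ha hb (ContinuousLinearMap.mul ℝ ℝ)
    rw [posConvolution, integrable_indicator_iff measurableSet_Ioi] at this
    simp_rw [key]
    exact this
  · have := integral_posConvolution ha hb (ContinuousLinearMap.mul ℝ ℝ)
    simp_rw [key]
    exact this

lemma ren_exp_int (s : ℝ) (hs : 0 < s) :
    IntegrableOn (fun t => (1:ℝ) * Real.exp (-(s * t))) (Ioi 0) ∧
    ∫ t in Ioi (0:ℝ), (1:ℝ) * Real.exp (-(s * t)) = 1 / s := by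
  have h1 := integrableOn_exp_mul_Ioi (a := -s) (by linarith) 0
  have h2 := integral_exp_mul_Ioi (a := -s) (by linarith) 0
  simp only [one_mul, neg_mul] at *
  refine ⟨h1, ?_⟩
  rw [h2]; simp

lemma ren_c (f : ℝ → ℝ) (hf0 : ∀ t : ℝ, 0 ≤ t → 0 ≤ f t) (hfi : IntegrableOn f (Ioi 0)) (n : ℕ) :
    (∀ x : ℝ, 0 ≤ x → 0 ≤ convIter f n x) ∧ ∀ s : ℝ, 0 ≤ s →
      IntegrableOn (fun t => convIter f n t * Real.exp (-(s * t))) (Ioi 0) ∧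
      ∫ t in Ioi (0:ℝ), convIter f n t * Real.exp (-(s * t)) =
        (∫ t in Ioi (0:ℝ), f t * Real.exp (-(s * t))) ^ (n + 1) := by
  have hbase : ∀ s : ℝ, 0 ≤ s → IntegrableOn (fun t => f t * Real.exp (-(s * t))) (Ioi 0) := by
    intro s hs
    refine Integrable.mul_bdd (c := 1) hfi
      (by fun_prop : Continuous fun t : ℝ => Real.exp (-(s * t))).aestronglyMeasurable ?_
    filter_upwards [ae_restrict_mem measurableSet_Ioi] with x hx
    have hx : 0 < x := hx
    rw [Real.norm_of_nonneg (Real.exp_pos _).le, Real.exp_le_one_iff]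
    have := mul_nonneg hs hx.le
    linarith
  induction n with
  | zero => 
    refine ⟨hf0, fun s hs => ⟨hbase s hs, ?_⟩⟩
    simp [convIter]
  | succ n ih =>
    refine ⟨?_, fun s hs => ?_⟩
    · intro x hx
      simp only [convIter]
      apply intervalIntegral.integral_nonneg hx
      intro u hu
      exact mul_nonneg (ih.1 _ (by linarith [hu.2])) (hf0 u hu.1)
    · have := ren_conv f (convIter f n) s (hbase s hs) (ih.2 s hs).1
      refine ⟨this.1, ?_⟩
      simp only [convIter]
      rw [this.2, (ih.2 s hs).2]
      ring

lemma ren_R (f : ℝ → ℝ) (hf0 : ∀ t : ℝ, 0 ≤ t → 0 ≤ f t) (hfi : IntegrableOn f (Ioi 0))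
    (φ : ℝ → ℝ) (hφ0 : ∀ s, 0 < s → 0 ≤ φ s) (hφ1 : ∀ s, 0 < s → φ s < 1)
    (hL : ∀ s : ℝ, 0 < s → ∫ t in Ioi (0 : ℝ), f t * Real.exp (-(s * t)) = φ s)
    (R : ℝ → ℝ) (hR : ∀ x, R x = ∑' n : ℕ, ∫ u in (0:ℝ)..x, convIter f n u) :
    ContinuousOn R (Ioi 0) ∧ ∀ s : ℝ, 2 ≤ s →
      IntegrableOn (fun x => R x * Real.exp (-(s * x))) (Ioi 0) ∧
      ∫ x in Ioi (0:ℝ), R x * Real.exp (-(s * x)) = φ s / (s * (1 - φ s)) := by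
  set F : ℕ → ℝ → ℝ := fun n x => ∫ u in (0:ℝ)..x, convIter f n u with hF
  have hci : ∀ n, IntegrableOn (convIter f n) (Ioi 0) := by
    intro n
    simpa using ((ren_c f hf0 hfi n).2 0 le_rfl).1
  have hF0 : ∀ n x, 0 ≤ x → 0 ≤ F n x := by
    intro n x hx
    exact intervalIntegral.integral_nonneg hx fun u hu => (ren_c f hf0 hfi n).1 u hu.1
  have hFb : ∀ n x, 0 ≤ x → F n x ≤ Real.exp x * φ 1 ^ (n + 1) := by
    intro n x hx
    have h1 := (ren_c f hf0 hfi n).2 1 zero_le_one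
    rw [hL 1 one_pos] at h1
    rw [← h1.2, ← integral_const_mul]
    simp only [hF]
    rw [intervalIntegral.integral_of_le hx]
    have hi2 : IntegrableOn (fun t => Real.exp x * (convIter f n t * Real.exp (-(1 * t)))) (Ioi 0) :=
      h1.1.const_mul _
    calc ∫ u in Ioc 0 x, convIter f n u 
        ≤ ∫ t in Ioc 0 x, Real.exp x * (convIter f n t * Real.exp (-(1 * t))) := by
          apply setIntegral_mono_on ((hci n).mono_set Ioc_subset_Ioi_self)
            (hi2.mono_set Ioc_subset_Ioi_self) measurableSet_Ioc
          intro t ht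
          have e1 : 1 ≤ Real.exp x * Real.exp (-(1 * t)) := by
            rw [← Real.exp_add, Real.one_le_exp_iff]; linarith [ht.2]
          have := (ren_c f hf0 hfi n).1 t ht.1.le
          nlinarith
      _ ≤ _ := by
          apply setIntegral_mono_set hi2 _ (LE.le.eventuallyLE Ioc_subset_Ioi_self)
          filter_upwards [ae_restrict_mem measurableSet_Ioi] with t ht
          have := (ren_c f hf0 hfi n).1 t (le_of_lt ht)
          simp only [Pi.zero_apply]
          positivity
  have hgeo : ∀ s, 0 < s → HasSum (fun n : ℕ => φ s ^ (n + 1)) (φ s / (1 - φ s)) := by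
    intro s hs
    have := (hasSum_geometric_of_lt_one (hφ0 s hs) (hφ1 s hs)).mul_left (φ s)
    simpa [pow_succ', div_eq_mul_inv] using this
  have hcontX : ∀ X : ℝ, 0 < X → ContinuousOn R (Icc 0 X) := by
    intro X hX
    have : R = fun x => ∑' n, F n x := funext hR
    rw [this]
    apply continuousOn_tsum (u := fun n => Real.exp X * φ 1 ^ (n + 1))
    · intro n
      have := intervalIntegral.continuousOn_primitive_interval (f := convIter f n) (a := 0) (b := X)
        (μ := volume) (by
          rw [uIcc_of_le hX.le, integrableOn_Icc_iff_integrableOn_Ioc]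
          exact (hci n).mono_set Ioc_subset_Ioi_self)
      rwa [uIcc_of_le hX.le] at this
    · exact (hgeo 1 one_pos).summable.mul_left _
    · intro n x hx
      rw [Real.norm_of_nonneg (hF0 n x hx.1)]
      refine (hFb n x hx.1).trans ?_
      have := hφ0 1 one_pos
      have := Real.exp_le_exp.mpr hx.2
      gcongr
  have hcont : ContinuousOn R (Ioi 0) := by
    intro x hx
    have hx : 0 < x := hx
    apply ContinuousAt.continuousWithinAt
    exact (hcontX (x + 1) (by linarith)).continuousAt (Icc_mem_nhds hx (by linarith))
  refine ⟨hcont, fun s hs => ?_⟩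
  have hs0 : 0 < s := by linarith
  have hRb : ∀ x, 0 ≤ x → ‖R x‖ ≤ Real.exp x * (φ 1 / (1 - φ 1)) := by
    intro x hx
    rw [hR]
    apply tsum_of_norm_bounded ((hgeo 1 one_pos).mul_left (Real.exp x))
    intro n
    rw [Real.norm_of_nonneg (hF0 n x hx)]
    exact hFb n x hx
  constructor
  · have hdom : IntegrableOn (fun x => (φ 1 / (1 - φ 1)) * ((1:ℝ) * Real.exp (-((s - 1) * x)))) (Ioi 0) :=
      (ren_exp_int (s - 1) (by linarith)).1.const_mul _
    refine Integrable.mono' hdom ?_ ?_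
    · apply ContinuousOn.aestronglyMeasurable _ measurableSet_Ioi
      exact hcont.mul (by fun_prop)
    · filter_upwards [ae_restrict_mem measurableSet_Ioi] with x hx
      rw [norm_mul, Real.norm_of_nonneg (Real.exp_pos _).le]
      have e1 : Real.exp (-((s - 1) * x)) = Real.exp x * Real.exp (-(s * x)) := by
        rw [← Real.exp_add]; ring_nf
      rw [e1]
      have := mul_le_mul_of_nonneg_right (hRb x (le_of_lt hx)) (Real.exp_pos (-(s * x))).le
      linarith
  · have hFL : ∀ n, IntegrableOn (fun x => F n x * Real.exp (-(s * x))) (Ioi 0) ∧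
        ∫ x in Ioi (0:ℝ), F n x * Real.exp (-(s * x)) = φ s ^ (n + 1) * (1 / s) := by
      intro n
      have h1 := (ren_c f hf0 hfi n).2 s hs0.le
      have h2 := ren_conv (convIter f n) (fun _ => 1) s h1.1 (ren_exp_int s hs0).1
      rw [h1.2, (ren_exp_int s hs0).2, hL s hs0] at h2
      simpa only [one_mul] using h2
    have hnorm : ∀ n, ∫ x in Ioi (0:ℝ), ‖F n x * Real.exp (-(s * x))‖ = φ s ^ (n + 1) * (1 / s) := by
      intro n
      rw [← (hFL n).2]
      apply setIntegral_congr_fun measurableSet_Ioi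
      intro x hx
      exact Real.norm_of_nonneg (mul_nonneg (hF0 n x (le_of_lt hx)) (Real.exp_pos _).le)
    have hsum := hasSum_integral_of_summable_integral_norm
      (F := fun n x => F n x * Real.exp (-(s * x))) (μ := volume.restrict (Ioi (0:ℝ)))
      (fun n => (hFL n).1) (by
        simp_rw [hnorm]; exact (hgeo s hs0).summable.mul_right _)
    simp_rw [(hFL _).2, tsum_mul_right] at hsum
    have h3 := hsum.unique ((hgeo s hs0).mul_right (1 / s))
    simp_rw [hR]
    rw [h3]
    have : 1 - φ s ≠ 0 := by linarith [hφ1 s hs0]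
    field_simp

lemma ren_g (M : ℕ) (sr A : Fin M → ℂ) (hre : ∀ r, 0 < (sr r).re) (a s : ℝ) (hs : 0 < s) :
    IntegrableOn (fun x : ℝ => (Real.exp (-(s * x)) : ℂ) * (((x * a : ℝ) : ℂ) -
        ∑ r, A r * (1 - Complex.exp (-(sr r * (x : ℂ)))))) (Ioi 0) ∧
    ∫ x in Ioi (0:ℝ), (Real.exp (-(s * x)) : ℂ) * (((x * a : ℝ) : ℂ) -
        ∑ r, A r * (1 - Complex.exp (-(sr r * (x : ℂ))))) =
      a / (s:ℂ) ^ 2 - ∑ r, A r * (1 / (s:ℂ) - 1 / (s + sr r)) := by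
  have e0 := ren_exp_int s hs
  have h1 := ren_conv (fun _ => 1) (fun _ => 1) s e0.1 e0.1
  rw [e0.2] at h1
  simp only [mul_one, intervalIntegral.integral_const, sub_zero, smul_eq_mul] at h1
  have i1 : IntegrableOn (fun x : ℝ => (((x * Real.exp (-(s * x)) : ℝ)) : ℂ) * a) (Ioi 0) :=
    h1.1.ofReal.mul_const _
  have v1 : ∫ x in Ioi (0:ℝ), (((x * Real.exp (-(s * x)) : ℝ)) : ℂ) * a = a / (s:ℂ) ^ 2 := by
    rw [integral_mul_const, integral_complex_ofReal, h1.2]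
    push_cast; ring
  have i2 : IntegrableOn (fun x : ℝ => ((1 * Real.exp (-(s * x)) : ℝ) : ℂ)) (Ioi 0) := e0.1.ofReal
  have v2 : ∫ x in Ioi (0:ℝ), ((1 * Real.exp (-(s * x)) : ℝ) : ℂ) = 1 / s := by
    rw [integral_complex_ofReal, e0.2]; push_cast; rfl
  have hneg : ∀ r, (-(s + sr r)).re < 0 := by
    intro r; have := hre r; simp; linarith
  have i3 : ∀ r, IntegrableOn (fun x : ℝ => Complex.exp (-(s + sr r) * x)) (Ioi 0) := fun r =>
    integrableOn_exp_mul_complex_Ioi (hneg r) 0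
  have v3 : ∀ r, ∫ x in Ioi (0:ℝ), Complex.exp (-(s + sr r) * x) = 1 / (s + sr r) := by
    intro r
    rw [integral_exp_mul_complex_Ioi (hneg r) 0]
    rw [ofReal_zero, mul_zero, Complex.exp_zero, neg_div_neg_eq]
  have i4 : ∀ r, IntegrableOn (fun x : ℝ => A r * (((1 * Real.exp (-(s * x)) : ℝ) : ℂ) -
      Complex.exp (-(s + sr r) * x))) (Ioi 0) := fun r => (i2.sub (i3 r)).const_mul _
  have key : ∀ x : ℝ, (Real.exp (-(s * x)) : ℂ) * (((x * a : ℝ) : ℂ) -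
        ∑ r, A r * (1 - Complex.exp (-(sr r * (x : ℂ))))) =
      (((x * Real.exp (-(s * x)) : ℝ)) : ℂ) * a - ∑ r, A r * (((1 * Real.exp (-(s * x)) : ℝ) : ℂ) -
      Complex.exp (-(s + sr r) * x)) := by
    intro x
    rw [mul_sub, Finset.mul_sum]
    congr 1
    · push_cast; ring
    · apply Finset.sum_congr rfl
      intro r _
      have : Complex.exp (-(s + sr r) * x) = (Real.exp (-(s * x)) : ℂ) * Complex.exp (-(sr r * (x : ℂ))) := by
        push_cast
        rw [← Complex.exp_add]; ring_nf
      rw [this]; push_cast; ring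
  simp_rw [key]
  have i5 := integrable_finsetSum Finset.univ fun r _ => i4 r
  refine ⟨i1.sub i5, ?_⟩
  rw [integral_sub i1 i5, v1, integral_finsetSum Finset.univ fun r _ => i4 r]
  congr 1
  apply Finset.sum_congr rfl
  intro r _
  rw [integral_const_mul, integral_sub i2 (i3 r), v2, v3]

lemma ren_pf (M : ℕ) (sr : Fin M → ℂ) (hdist : Function.Injective sr) (hne0 : ∀ r, sr r ≠ 0)
    (p q : ℂ[X]) (hq : q = X ^ 2 * ∏ r : Fin M, (X + C (sr r))) (hdeg : p.natDegree ≤ M)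
    (a : ℂ) (hp0 : p.eval 0 = a * ∏ r, sr r) (s : ℂ) (hs : s ≠ 0) (hsr : ∀ r, s + sr r ≠ 0) :
    p.eval s / q.eval s = a / s ^ 2 - ∑ r, (p.eval (-(sr r)) / (derivative q).eval (-(sr r))) *
      (1 / s - 1 / (s + sr r)) := by
  set A : Fin M → ℂ := fun r => p.eval (-(sr r)) / (derivative q).eval (-(sr r)) with hA
  set Q : Fin M → ℂ[X] := fun r => ∏ j ∈ Finset.univ.erase r, (X + C (sr j)) with hQ
  have hQQ : ∀ r, ∏ j, (X + C (sr j)) = (X + C (sr r)) * Q r := fun r =>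
    (Finset.mul_prod_erase _ _ (Finset.mem_univ r)).symm
  have hQne : ∀ r, (Q r).eval (-(sr r)) ≠ 0 := by
    intro r
    simp only [hQ, eval_prod]
    rw [Finset.prod_ne_zero_iff]
    intro j hj h0
    simp only [eval_add, eval_X, eval_C] at h0
    have : sr j = sr r := by linear_combination h0
    exact (Finset.ne_of_mem_erase hj) (hdist this)
  have hq' : ∀ r, (derivative q).eval (-(sr r)) = sr r ^ 2 * (Q r).eval (-(sr r)) := by
    intro r
    rw [hq, hQQ r]
    simp [derivative_mul]
  have hAq : ∀ r, p.eval (-(sr r)) = A r * (sr r ^ 2 * (Q r).eval (-(sr r))) := by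
    intro r
    simp only [hA]
    rw [hq', div_mul_cancel₀]
    exact mul_ne_zero (pow_ne_zero _ (hne0 r)) (hQne r)
  have hQdeg : ∀ r, (Q r).natDegree + 1 = M := by
    intro r
    simp only [hQ]
    rw [natDegree_prod_of_monic _ _ fun j _ => monic_X_add_C _]
    simp
    have := r.pos
    omega
  set P : ℂ[X] := C a * (∏ j, (X + C (sr j))) - ∑ r, C (A r * sr r) * (X * Q r) with hP
  have hPdeg : P.natDegree ≤ M := by
    apply (natDegree_sub_le _ _).trans
    apply max_le
    · apply (natDegree_C_mul_le _ _).trans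
      rw [natDegree_prod_of_monic _ _ fun j _ => monic_X_add_C _]
      simp
    · apply natDegree_sum_le_of_forall_le
      intro r _
      apply (natDegree_C_mul_le _ _).trans
      apply natDegree_mul_le.trans
      have := hQdeg r
      simp
      omega
  have hpP : p = P := by
    rw [← sub_eq_zero]
    apply eq_zero_of_natDegree_lt_card_of_eval_eq_zero (p - P)
      (f := fun o : Option (Fin M) => o.elim 0 (fun r => -(sr r)))
    · rintro (_ | i) (_ | j) h
      · rfl
      · simp at h; exact absurd h (hne0 j)
      · simp at h; exact absurd h (hne0 i)
      · simp at h; rw [hdist h]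
    · rintro (_ | j)
      · simp [hp0, hP, eval_prod, eval_finsetSum]
      · simp only [Option.elim, eval_sub, hP, eval_mul, eval_C, eval_finsetSum, eval_X]
        rw [Finset.sum_eq_single j]
        · rw [hQQ j, hAq]
          simp
          ring
        · intro r _ hr
          have : (Q r).eval (-(sr j)) = 0 := by
            simp only [hQ, eval_prod]
            apply Finset.prod_eq_zero (Finset.mem_erase.mpr ⟨hr.symm, Finset.mem_univ j⟩)
            simp
          rw [this]; ring
        · simp
    · have := natDegree_sub_le p P
      simp
      omega
  have hQs : ∀ r, (∏ j, (s + sr j)) = (s + sr r) * (Q r).eval s := by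
    intro r
    have := congrArg (eval s) (hQQ r)
    simpa [eval_prod] using this
  have hQ0 : (∏ j, (s + sr j)) ≠ 0 := Finset.prod_ne_zero_iff.mpr fun j _ => hsr j
  have hqs : q.eval s = s ^ 2 * ∏ j, (s + sr j) := by rw [hq]; simp [eval_prod]
  have hps : p.eval s = a * (∏ j, (s + sr j)) - ∑ r, (A r * sr r) * (s * (Q r).eval s) := by
    conv_lhs => rw [hpP]
    simp [hP, eval_prod, eval_finsetSum]
  rw [hqs, hps, sub_div, Finset.sum_div]
  congr 1
  · field_simp
  · apply Finset.sum_congr rfl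
    intro r _
    have h1 := hsr r
    rw [hQs r] at hQ0 ⊢
    have h2 := (mul_ne_zero_iff.mp hQ0).2
    field_simp
    ring

lemma ren_deg (G : ℕ) (hG : 1 ≤ G) (kon koff : ℝ) (k : ℕ → ℝ)
    (hkon : 0 < kon) (hkoff : 0 < koff) (hk : ∀ i ∈ Finset.Icc 1 G, 0 < k i)
    (φ : ℝ → ℝ)
    (hφ : ∀ s : ℝ, φ s =
      k 1 * (s + kon) / (s ^ 2 + s * (k 1 + kon + koff) + k 1 * kon) *
        ∏ i ∈ Finset.Icc 2 G, k i / (s + k i))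
    (hφ1 : ∀ s, 0 < s → φ s < 1)
    (α : ℝ) (hα : α = (kon + koff) / (kon * k 1) + ∑ i ∈ Finset.Icc 2 G, 1 / k i)
    (M : ℕ) (sr : Fin M → ℂ) (hre : ∀ r, 0 < (sr r).re)
    (p q : Polynomial ℂ) (hq : q = X ^ 2 * ∏ r : Fin M, (X + C (sr r)))
    (hratio : ∀ s : ℝ, 0 < s →
      ((φ s : ℂ)) / ((s : ℂ) * (1 - (φ s : ℂ))) = p.eval (s : ℂ) / q.eval (s : ℂ)) :
    p.natDegree ≤ M ∧ p.eval 0 = ((1 / α : ℝ) : ℂ) * ∏ r, sr r := by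
  have hk1 : 0 < k 1 := hk 1 (by simp [hG])
  have hk2 : ∀ i ∈ Finset.Icc 2 G, 0 < k i := fun i hi => hk i (by
    simp only [Finset.mem_Icc] at hi ⊢; omega)
  set K : ℂ := ∏ i ∈ Finset.Icc 2 G, (k i : ℂ) with hK
  have hK0 : K ≠ 0 := Finset.prod_ne_zero_iff.mpr fun i hi => by
    exact_mod_cast (hk2 i hi).ne'
  set B : ℂ[X] := ∏ i ∈ Finset.Icc 2 G, (X + C (k i : ℂ)) with hB
  set N : ℂ[X] := C (k 1 * K) * (X + C (kon : ℂ)) with hN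
  set T : ℂ[X] := X ^ 2 + C ((k 1 + kon + koff : ℂ)) * X + C (k 1 * kon : ℂ) with hT
  set S : ℂ[X] := ∏ r, (X + C (sr r)) with hS
  have hBm : B.Monic := monic_prod_of_monic _ _ fun i _ => monic_X_add_C _
  have hBd : B.natDegree = G - 1 := by
    rw [hB, natDegree_prod_of_monic _ _ fun j _ => monic_X_add_C _]
    simp
  have hTm : T.Monic := by rw [hT]; monicity!
  have hTd : T.natDegree = 2 := by rw [hT]; compute_degree!
  have hSm : S.Monic := monic_prod_of_monic _ _ fun i _ => monic_X_add_C _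
  have hSd : S.natDegree = M := by
    rw [hS, natDegree_prod_of_monic _ _ fun j _ => monic_X_add_C _]
    simp
  have hpoly : N * q = p * X * (T * B - N) := by
    apply eq_of_infinite_eval_eq
    apply ((Set.Ioi_infinite (0:ℝ)).image (Complex.ofReal_injective.injOn)).mono
    rintro _ ⟨s, hs, rfl⟩
    have hs : 0 < s := hs
    have h1 := hratio s hs
    have hs' : (s : ℂ) ≠ 0 := by exact_mod_cast hs.ne'
    have hT0 : T.eval (s:ℂ) ≠ 0 := by
      have : 0 < s ^ 2 + (k 1 + kon + koff) * s + k 1 * kon := by positivity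
      simp only [hT, eval_add, eval_mul, eval_pow, eval_X, eval_C]
      exact_mod_cast this.ne'
    have hB0 : B.eval (s:ℂ) ≠ 0 := by
      simp only [hB, eval_prod, eval_add, eval_X, eval_C]
      refine Finset.prod_ne_zero_iff.mpr fun i hi => ?_
      have := hk2 i hi
      have : 0 < s + k i := by linarith
      exact_mod_cast this.ne'
    have hq0 : q.eval (s:ℂ) ≠ 0 := by
      rw [hq, eval_mul, eval_pow, eval_X, eval_prod]
      refine mul_ne_zero (pow_ne_zero _ hs') (Finset.prod_ne_zero_iff.mpr fun r _ => ?_)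
      intro h0
      have := congrArg Complex.re h0
      simp at this
      have := hre r
      linarith
    have hφs : (φ s : ℂ) = N.eval (s:ℂ) / (T.eval (s:ℂ) * B.eval (s:ℂ)) := by
      rw [hφ s]
      simp only [hN, hT, hB, hK, eval_mul, eval_C, eval_add, eval_X, eval_pow, eval_prod]
      push_cast
      rw [Finset.prod_div_distrib, div_mul_div_comm]
      congr 1 <;> ring
    have hφne : 1 - (φ s : ℂ) ≠ 0 := by
      have : 0 < 1 - φ s := by linarith [hφ1 s hs]
      exact_mod_cast this.ne'
    rw [div_eq_div_iff (mul_ne_zero hs' hφne) hq0] at h1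
    rw [hφs] at h1
    have hTB := mul_ne_zero hT0 hB0
    simp only [Set.mem_ofPred_eq, eval_mul, eval_sub, eval_X]
    field_simp at h1
    linear_combination h1
  constructor
  · by_cases hp : p = 0
    · simp [hp]
    have hTB : (T * B).Monic := hTm.mul hBm
    have hTBd : (T * B).natDegree = G + 1 := by
      rw [hTm.natDegree_mul hBm, hTd, hBd]; omega
    have hNd : N.natDegree ≤ 1 := by
      rw [hN]; exact (natDegree_C_mul_le _ _).trans (natDegree_X_add_C _).le
    have hEd : (T * B - N).natDegree = G + 1 := by
      rw [natDegree_sub_eq_left_of_natDegree_lt (by omega), hTBd]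
    have hE0 : T * B - N ≠ 0 := by
      intro h; rw [h] at hEd; simp at hEd
    have hd := congrArg natDegree hpoly
    rw [natDegree_mul (mul_ne_zero hp X_ne_zero) hE0, natDegree_mul hp X_ne_zero, hEd,
      natDegree_X] at hd
    have h2 : (N * q).natDegree ≤ 1 + (2 + M) := by
      apply natDegree_mul_le.trans
      have : q.natDegree ≤ 2 + M := by
        rw [hq]
        apply natDegree_mul_le.trans
        rw [hSd]; simp
      omega
    omega
  · have h3 : N * X * S = p * (T * B - N) := by
      apply mul_left_cancel₀ (X_ne_zero (R := ℂ))
      rw [hq] at hpoly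
      linear_combination hpoly
    have h4 := congrArg (fun P => (derivative P).eval 0) h3
    have hB0 : B.eval 0 = K := by simp [hB, hK, eval_prod]
    have hS0 : S.eval 0 = ∏ r, sr r := by simp [hS, eval_prod]
    have hB' : (derivative B).eval 0 = K * ∑ i ∈ Finset.Icc 2 G, 1 / (k i : ℂ) := by
      rw [hB, derivative_prod_finset, eval_finsetSum, Finset.mul_sum]
      apply Finset.sum_congr rfl
      intro i hi
      have : (k i : ℂ) ≠ 0 := by exact_mod_cast (hk2 i hi).ne'
      rw [hK, ← Finset.mul_prod_erase _ _ hi]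
      simp [eval_prod]
      field_simp
    have hαc : (α : ℂ) = (kon + koff) / (kon * k 1) + ∑ i ∈ Finset.Icc 2 G, 1 / (k i : ℂ) := by
      rw [hα]; push_cast; rfl
    have hαpos : 0 < α := by
      rw [hα]
      have : 0 ≤ ∑ i ∈ Finset.Icc 2 G, 1 / k i :=
        Finset.sum_nonneg fun i hi => (one_div_pos.mpr (hk2 i hi)).le
      positivity
    have hα0 : (α : ℂ) ≠ 0 := by exact_mod_cast hαpos.ne'
    have hk1c : (k 1 : ℂ) ≠ 0 := by exact_mod_cast hk1.ne'
    have hkonc : (kon : ℂ) ≠ 0 := by exact_mod_cast hkon.ne'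
    simp only [derivative_mul, derivative_sub, eval_add, eval_mul, eval_sub, hB', hB0, hS0] at h4
    simp [hN, hT] at h4
    have h5 : k 1 * K * kon * ∏ r, sr r = p.eval 0 * (k 1 * K * kon * α) := by
      rw [hαc]
      simp only [one_div] at h4 ⊢
      generalize (∑ x ∈ Finset.Icc 2 G, ((k x : ℂ))⁻¹) = W at h4 ⊢
      rw [h4]
      field_simp
      ring
    have h6 : (k 1 * K * kon : ℂ) ≠ 0 := mul_ne_zero (mul_ne_zero hk1c hK0) hkonc
    have h7 : ∏ r, sr r = p.eval 0 * α := by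
      apply mul_left_cancel₀ h6
      linear_combination h5
    rw [h7]; push_cast; field_simp

/-- explicit form of the renewal function of the nascent mRNA
arrival process, via partial fractions of its Laplace transform. -/
theorem renewal_function_explicit
    (G : ℕ) (hG : 1 ≤ G) (kon koff : ℝ) (k : ℕ → ℝ)
    (hkon : 0 < kon) (hkoff : 0 < koff) (hk : ∀ i ∈ Finset.Icc 1 G, 0 < k i)
    (φ : ℝ → ℝ)
    (hφ : ∀ s : ℝ, φ s =
      k 1 * (s + kon) / (s ^ 2 + s * (k 1 + kon + koff) + k 1 * kon) *
        ∏ i ∈ Finset.Icc 2 G, k i / (s + k i))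
    (α : ℝ) (hα : α = (kon + koff) / (kon * k 1) + ∑ i ∈ Finset.Icc 2 G, 1 / k i)
    (f : ℝ → ℝ)
    (hf_nonneg : ∀ t : ℝ, 0 ≤ t → 0 ≤ f t)
    (hf_int : IntegrableOn f (Ioi 0))
    (hf_norm : ∫ t in Ioi (0 : ℝ), f t = 1)
    (hf_LT : ∀ s : ℝ, 0 < s → ∫ t in Ioi (0 : ℝ), f t * Real.exp (-(s * t)) = φ s)
    (Fn : ℕ → ℝ → ℝ) (hFn : ∀ n : ℕ, ∀ x : ℝ, Fn n x = ∫ u in (0 : ℝ)..x, convIter f n u)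
    (R : ℝ → ℝ) (hR : ∀ x : ℝ, R x = ∑' n : ℕ, Fn n x)
    (M : ℕ) (sr : Fin M → ℂ)
    (hdist : Function.Injective sr) (hne0 : ∀ r, sr r ≠ 0)
    (hre : ∀ r, 0 < (sr r).re)
    (p q : Polynomial ℂ) (hcop : IsCoprime p q)
    (hq : q = X ^ 2 * ∏ r : Fin M, (X + C (sr r)))
    (hratio : ∀ s : ℝ, 0 < s →
      ((φ s : ℂ)) / ((s : ℂ) * (1 - (φ s : ℂ))) = p.eval (s : ℂ) / q.eval (s : ℂ)) :
    ∀ x : ℝ, 0 ≤ x →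
      ((R x : ℝ) : ℂ) = ((x / α : ℝ) : ℂ) -
        ∑ r : Fin M,
          (p.eval (-(sr r)) / (Polynomial.derivative q).eval (-(sr r))) *
            (1 - Complex.exp (-(sr r * (x : ℂ)))) := by
  have hk1 : 0 < k 1 := hk 1 (by simp [hG])
  have hk2 : ∀ i ∈ Finset.Icc 2 G, 0 < k i := fun i hi => hk i (by
    simp only [Finset.mem_Icc] at hi ⊢; omega)
  have hφ0 : ∀ s, 0 < s → 0 ≤ φ s := by
    intro s hs
    rw [hφ]
    apply mul_nonneg (by positivity)
    apply Finset.prod_nonneg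
    intro i hi
    have := hk2 i hi
    positivity
  have hφ1 : ∀ s, 0 < s → φ s < 1 := by
    intro s hs
    rw [hφ]
    have h1 : k 1 * (s + kon) / (s ^ 2 + s * (k 1 + kon + koff) + k 1 * kon) < 1 := by
      rw [div_lt_one (by positivity)]
      have : 0 < s ^ 2 + s * (kon + koff) := by positivity
      nlinarith
    have h2 : ∏ i ∈ Finset.Icc 2 G, k i / (s + k i) ≤ 1 := by
      apply Finset.prod_le_one
      · intro i hi
        have := hk2 i hi
        positivity
      · intro i hi
        have := hk2 i hi
        rw [div_le_one (by positivity)]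
        linarith
    have h3 : 0 ≤ k 1 * (s + kon) / (s ^ 2 + s * (k 1 + kon + koff) + k 1 * kon) := by positivity
    exact (mul_le_of_le_one_right h3 h2).trans_lt h1
  have hRR : ∀ x, R x = ∑' n : ℕ, ∫ u in (0:ℝ)..x, convIter f n u := by
    intro x; rw [hR]; simp_rw [hFn]
  obtain ⟨hRc, hRi⟩ := ren_R f hf_nonneg hf_int φ hφ0 hφ1 hf_LT R hRR
  obtain ⟨hdeg, hp0⟩ := ren_deg G hG kon koff k hkon hkoff hk φ hφ hφ1 α hα M sr hre p q hq hratio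
  intro x hx
  rcases hx.eq_or_lt with rfl | hx
  · simp [hRR]
  set A : Fin M → ℂ := fun r => p.eval (-(sr r)) / (Polynomial.derivative q).eval (-(sr r)) with hA
  set g : ℝ → ℂ := fun x => ((x * (1 / α) : ℝ) : ℂ) -
        ∑ r, A r * (1 - Complex.exp (-(sr r * (x : ℂ)))) with hg
  have hgc : Continuous g := by fun_prop
  have main : ∀ s : ℝ, 2 ≤ s →
      IntegrableOn (fun x : ℝ => (Real.exp (-(s * x)) : ℂ) * (R x - g x)) (Ioi 0) ∧
      ∫ x in Ioi (0:ℝ), (Real.exp (-(s * x)) : ℂ) * (R x - g x) = 0 := by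
    intro s hs
    have hs0 : 0 < s := by linarith
    obtain ⟨r1, r2⟩ := hRi s hs
    obtain ⟨g1, g2⟩ := ren_g M sr A hre (1 / α) s hs0
    have r1' : IntegrableOn (fun x => ((R x * Real.exp (-(s * x)) : ℝ) : ℂ)) (Ioi 0) := r1.ofReal
    have e : ∀ x : ℝ, (Real.exp (-(s * x)) : ℂ) * (R x - g x) =
        ((R x * Real.exp (-(s * x)) : ℝ) : ℂ) - (Real.exp (-(s * x)) : ℂ) * g x := by
      intro x; push_cast; ring
    simp_rw [e]
    refine ⟨r1'.sub g1, ?_⟩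
    rw [integral_sub r1' g1, integral_complex_ofReal, r2, g2]
    have hpf := ren_pf M sr hdist hne0 p q hq hdeg _ hp0 (s : ℂ) (by exact_mod_cast hs0.ne') (by
      intro r h0
      have := congrArg Complex.re h0
      simp at this
      have := hre r
      linarith)
    rw [← hpf, ← hratio s hs0]
    push_cast
    ring
  have hfin := ren_unique (fun x => (Real.exp (-(2 * x)) : ℂ) * (R x - g x)) (main 2 le_rfl).1
    (by
      apply ContinuousOn.mul (by fun_prop)
      exact (Complex.continuous_ofReal.comp_continuousOn hRc).sub hgc.continuousOn)
    (by
      intro n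
      rw [← (main (n + 2) (by have := n.cast_nonneg (α := ℝ); linarith)).2]
      congr 1
      ext x
      rw [Complex.real_smul, ← mul_assoc]
      congr 1
      rw [← Complex.ofReal_mul, ← Real.exp_nat_mul, ← Real.exp_add]
      ring_nf) x hx
  have h9 : (R x : ℂ) - g x = 0 := by
    rcases mul_eq_zero.mp hfin with h | h
    · exact absurd h (by exact_mod_cast (Real.exp_pos _).ne')
    · exact h
  rw [sub_eq_zero.mp h9]
  simp only [hg, hA, mul_one_div]
end

section
/- Fix an integer G ≥ 1, an integer S ≥ 2, positive reals k_on, k_off, k_1, …, k_G, δ, δ_1 with δ ≠ δ_1, and let α = (k_on + k_off)/(k_on k_1) + Σ_{i=2}^G 1/k_i. Let s_1, …, s_M be pairwise distinct nonzero complex numbers with positive real part, none equal to δ or δ_1, let A_1, …, A_M be complex numbers, and set R(x) = x/α − Σ_{r=1}^M A_r (1 − e^{−s_r x}). Let H^N(t) = γ(S−1, δ t)/(S−2)! − (δ/(δ − δ_1))^{S−1} γ(S−1, (δ − δ_1) t) e^{−δ_1 t}/(S−2)!, where γ(n,t) := (n−1)!·(1 − e^{−t} Σ_{i=0}^{n−1}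 t^i/i!). Define φ(n,a,b,t) = γ(n, a t)/b − (a/(a−b))^n γ(n, (a−b) t) e^{−b t}/b when b ≠ 0, and φ(n,a,0,t) = t γ(n, a t) − γ(n+1, a t)/a. Then for every t ≥ 0, ∫_0^t R'(x) (1 − H^N(t−x)) dx = R(t) − (1/α)[φ(S−1, δ, 0, t)/(S−2)! − (δ/(δ−δ_1))^{S−1} φ(S−1, δ−δ_1, −δ_1, t) e^{−δ_1 t}/(S−2)!] + Σ_{r=1}^M A_r s_r [φ(S−1, δ, s_r, t)/(S−2)! − (δ/(δ−δ_1))^{S−1} φ(S−1, δ−δ_1, s_r − δ_1, t) e^{−δ_1 t}/(S−2)!]. -/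
open Complex MeasureTheory

/-- Real lower incomplete Gamma function at positive integer shape `n`:
`γ(n,t) = (n−1)!·(1 − e^{−t} Σ_{i=0}^{n−1} t^i/i!)`. -/
noncomputable def lgam (n : ℕ) (t : ℝ) : ℝ :=
  (Nat.factorial (n - 1) : ℝ) *
    (1 - Real.exp (-t) * ∑ i ∈ Finset.range n, t ^ i / (Nat.factorial i : ℝ))

/-- Complex version of the lower incomplete Gamma function at positive
integer shape. -/
noncomputable def lgamC (n : ℕ) (t : ℂ) : ℂ :=
  (Nat.factorial (n - 1) : ℂ) *
    (1 - Complex.exp (-t) * ∑ i ∈ Finset.range n, t ^ i / (Nat.factorial i : ℂ))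

/-- The auxiliary function `φ(n,a,b,t)` of Proposition 1:
`φ(n,a,b,t) = γ(n,at)/b − (a/(a−b))^n γ(n,(a−b)t) e^{−bt}/b` for `b ≠ 0`,
and `φ(n,a,0,t) = t γ(n,at) − γ(n+1,at)/a`. -/
noncomputable def phiAux (n : ℕ) (a b t : ℂ) : ℂ :=
  if b = 0 then t * lgamC n (a * t) - lgamC (n + 1) (a * t) / a
  else lgamC n (a * t) / b -
    (a / (a - b)) ^ n * lgamC n ((a - b) * t) * Complex.exp (-(b * t)) / b

lemma lgamC_zero (m : ℕ) : lgamC (m + 1) 0 = 0 := by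
  simp [lgamC, Finset.sum_range_succ']

lemma lgamC_succ (m : ℕ) (y : ℂ) :
    lgamC (m + 2) y = (m + 1) * lgamC (m + 1) y - Complex.exp (-y) * y ^ (m + 1) := by
  have h : (Nat.factorial (m + 1) : ℂ) ≠ 0 := by exact_mod_cast Nat.factorial_ne_zero _
  have h1 : (Nat.factorial (m + 1) : ℂ) = (m + 1) * (Nat.factorial m : ℂ) := by
    push_cast [Nat.factorial_succ]; ring
  unfold lgamC
  rw [Finset.sum_range_succ _ (m + 1)]
  simp only [Nat.add_sub_cancel, show m + 2 - 1 = m + 1 from rfl]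
  have h2 : (Nat.factorial (m + 1) : ℂ) * (y ^ (m + 1) / (Nat.factorial (m + 1) : ℂ))
      = y ^ (m + 1) := by field_simp
  rw [← mul_assoc, ← h1]
  linear_combination (-Complex.exp (-y)) * h2

lemma lgamC_deriv (m : ℕ) (y : ℂ) :
    HasDerivAt (lgamC (m + 1)) (y ^ m * Complex.exp (-y)) y := by
  have he : HasDerivAt (fun y : ℂ => Complex.exp (-y)) (-Complex.exp (-y)) y := by
    simpa using (hasDerivAt_neg y).cexp
  induction m with
  | zero =>
    have : lgamC (0 + 1) = fun y => 1 - Complex.exp (-y) := by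
      funext y; simp [lgamC]
    rw [this]
    simpa using he.const_sub 1
  | succ m ih =>
    have : lgamC (m + 1 + 1) =
      fun y => ((m : ℂ) + 1) * lgamC (m + 1) y - Complex.exp (-y) * y ^ (m + 1) := by
      funext y; exact lgamC_succ m y
    rw [this]
    refine ((ih.const_mul ((m : ℂ) + 1)).sub (he.mul (hasDerivAt_pow (m + 1) y))).congr_deriv ?_
    push_cast
    try simp only [Nat.add_sub_cancel]
    ring

lemma lgamC_cont (m : ℕ) : Continuous (lgamC (m + 1)) :=
  continuous_iff_continuousAt.2 fun y => (lgamC_deriv m y).continuousAt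

lemma lgamC_comp_deriv (m : ℕ) (a : ℂ) (t x : ℝ) :
    HasDerivAt (fun x : ℝ => lgamC (m + 1) (a * ((t : ℂ) - (x : ℂ))))
      (-(a * ((a * ((t : ℂ) - (x : ℂ))) ^ m * Complex.exp (-(a * ((t : ℂ) - (x : ℂ))))))) x := by
  have h1 : HasDerivAt (fun x : ℝ => a * ((t : ℂ) - (x : ℂ))) (a * (-1)) x :=
    ((Complex.ofRealCLM.hasDerivAt (x := x)).const_sub (t : ℂ)).const_mul a
  refine (HasDerivAt.comp x (lgamC_deriv m _) h1).congr_deriv ?_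
  ring

lemma exp_comp_deriv (b : ℂ) (x : ℝ) :
    HasDerivAt (fun x : ℝ => Complex.exp (-(b * (x : ℂ))))
      (-(b * Complex.exp (-(b * (x : ℂ))))) x := by
  have h1 : HasDerivAt (fun x : ℝ => -(b * (x : ℂ))) (-(b * 1)) x :=
    ((Complex.ofRealCLM.hasDerivAt (x := x)).const_mul b).neg
  refine h1.cexp.congr_deriv ?_
  ring

lemma phi_int (m : ℕ) (a b : ℂ) (ha : a ≠ 0) (hab : a ≠ b) (t : ℝ) :
    (∫ x in (0 : ℝ)..t, lgamC (m + 1) (a * ((t : ℂ) - (x : ℂ))) * Complex.exp (-(b * (x : ℂ))))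
      = phiAux (m + 1) a b t := by
  have hcont : Continuous fun x : ℝ =>
      lgamC (m + 1) (a * ((t : ℂ) - (x : ℂ))) * Complex.exp (-(b * (x : ℂ))) := by
    have := lgamC_cont m
    fun_prop
  have hI := hcont.intervalIntegrable (μ := volume) 0 t
  unfold phiAux
  split_ifs with hb
  · subst hb
    have hd : ∀ x ∈ Set.uIcc (0 : ℝ) t, HasDerivAt
        (fun x : ℝ => lgamC (m + 1 + 1) (a * ((t : ℂ) - (x : ℂ))) / a
          - ((t : ℂ) - (x : ℂ)) * lgamC (m + 1) (a * ((t : ℂ) - (x : ℂ))))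
        (lgamC (m + 1) (a * ((t : ℂ) - (x : ℂ))) * Complex.exp (-(0 * (x : ℂ)))) x := by
      intro x _
      have h1 : HasDerivAt (fun x : ℝ => ((t : ℂ) - (x : ℂ))) (-1) x :=
        ((Complex.ofRealCLM.hasDerivAt (x := x)).const_sub (t : ℂ))
      refine (((lgamC_comp_deriv (m + 1) a t x).div_const a).sub
        (h1.mul (lgamC_comp_deriv m a t x))).congr_deriv ?_
      simp only [zero_mul, neg_zero, Complex.exp_zero]
      field_simp
      ring
    rw [intervalIntegral.integral_eq_sub_of_hasDerivAt hd hI]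
    simp [lgamC_zero]
  · have hab' : a - b ≠ 0 := sub_ne_zero.2 hab
    have hd : ∀ x ∈ Set.uIcc (0 : ℝ) t, HasDerivAt
        (fun x : ℝ => (a / (a - b)) ^ (m + 1) * Complex.exp (-(b * t)) / b *
            lgamC (m + 1) ((a - b) * ((t : ℂ) - (x : ℂ)))
          - lgamC (m + 1) (a * ((t : ℂ) - (x : ℂ))) * Complex.exp (-(b * (x : ℂ))) / b)
        (lgamC (m + 1) (a * ((t : ℂ) - (x : ℂ))) * Complex.exp (-(b * (x : ℂ)))) x := by
      intro x _
      refine (((lgamC_comp_deriv m (a - b) t x).const_mul _).sub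
        (((lgamC_comp_deriv m a t x).mul (exp_comp_deriv b x)).div_const b)).congr_deriv ?_
      have e1 : Complex.exp (-(b * t)) * Complex.exp (-((a - b) * ((t : ℂ) - (x : ℂ))))
          = Complex.exp (-(a * ((t : ℂ) - (x : ℂ)))) * Complex.exp (-(b * (x : ℂ))) := by
        rw [← Complex.exp_add, ← Complex.exp_add]; congr 1; ring
      have e2 : (a / (a - b)) ^ (m + 1) * (a - b) ^ (m + 1) = a ^ (m + 1) := by
        rw [← mul_pow, div_mul_cancel₀ _ hab']
      rw [mul_pow, mul_pow]
      generalize Complex.exp (-((a - b) * ((t : ℂ) - (x : ℂ)))) = E1 at *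
      generalize Complex.exp (-(a * ((t : ℂ) - (x : ℂ)))) = E2 at *
      generalize Complex.exp (-(b * (x : ℂ))) = E3 at *
      generalize Complex.exp (-(b * (t : ℂ))) = E4 at *
      generalize (a / (a - b)) ^ (m + 1) = C at *
      generalize lgamC (m + 1) (a * ((t : ℂ) - (x : ℂ))) = L at *
      generalize ((t : ℂ) - (x : ℂ)) ^ m = T at *
      rw [pow_succ, pow_succ] at e2
      generalize (a - b) ^ m = P at *
      generalize a ^ m = Q at *
      field_simp
      linear_combination (-(T * E4 * E1)) * e2 - T * Q * a * e1
    rw [intervalIntegral.integral_eq_sub_of_hasDerivAt hd hI]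
    simp [lgamC_zero]
    ring

lemma lgam_cast (n : ℕ) (x : ℝ) : ((lgam n x : ℝ) : ℂ) = lgamC n (x : ℂ) := by
  simp [lgam, lgamC]

/-- closed form of `B₁(t) = ∫_0^t R'(x)(1 − H^N(t−x)) dx`. -/
theorem first_binomial_moment_explicit
    (G S : ℕ) (hG : 1 ≤ G) (hS : 2 ≤ S)
    (kon koff δ δ₁ : ℝ) (k : ℕ → ℝ)
    (hkon : 0 < kon) (hkoff : 0 < koff) (hk : ∀ i ∈ Finset.Icc 1 G, 0 < k i)
    (hδ : 0 < δ) (hδ₁ : 0 < δ₁) (hδne : δ ≠ δ₁)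
    (α : ℝ) (hα : α = (kon + koff) / (kon * k 1) + ∑ i ∈ Finset.Icc 2 G, 1 / k i)
    (M : ℕ) (sr : Fin M → ℂ) (A : Fin M → ℂ)
    (hdist : Function.Injective sr) (hne0 : ∀ r, sr r ≠ 0)
    (hre : ∀ r, 0 < (sr r).re)
    (hneδ : ∀ r, sr r ≠ (δ : ℂ)) (hneδ₁ : ∀ r, sr r ≠ (δ₁ : ℂ))
    (R : ℝ → ℂ)
    (hR : ∀ x : ℝ, R x = ((x / α : ℝ) : ℂ) -
      ∑ r : Fin M, A r * (1 - Complex.exp (-(sr r * (x : ℂ)))))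
    (H : ℝ → ℝ)
    (hH : ∀ t : ℝ, H t = lgam (S - 1) (δ * t) / (Nat.factorial (S - 2) : ℝ) -
      (δ / (δ - δ₁)) ^ (S - 1) * lgam (S - 1) ((δ - δ₁) * t) *
        Real.exp (-(δ₁ * t)) / (Nat.factorial (S - 2) : ℝ)) :
    ∀ t : ℝ, 0 ≤ t →
      (∫ x in (0 : ℝ)..t, deriv R x * (((1 : ℝ) - H (t - x) : ℝ) : ℂ)) =
        R t -
          (1 / (α : ℂ)) *
            (phiAux (S - 1) (δ : ℂ) 0 (t : ℂ) / (Nat.factorial (S - 2) : ℂ) -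
              ((δ : ℂ) / ((δ : ℂ) - (δ₁ : ℂ))) ^ (S - 1) *
                phiAux (S - 1) ((δ : ℂ) - (δ₁ : ℂ)) (-(δ₁ : ℂ)) (t : ℂ) *
                Complex.exp (-((δ₁ : ℂ) * (t : ℂ))) / (Nat.factorial (S - 2) : ℂ)) +
          ∑ r : Fin M, A r * sr r *
            (phiAux (S - 1) (δ : ℂ) (sr r) (t : ℂ) / (Nat.factorial (S - 2) : ℂ) -
              ((δ : ℂ) / ((δ : ℂ) - (δ₁ : ℂ))) ^ (S - 1) *
                phiAux (S - 1) ((δ : ℂ) - (δ₁ : ℂ)) (sr r - (δ₁ : ℂ)) (t : ℂ) *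
                Complex.exp (-((δ₁ : ℂ) * (t : ℂ))) / (Nat.factorial (S - 2) : ℂ)) := by
  obtain ⟨m, rfl⟩ : ∃ m, S = m + 2 := ⟨S - 2, by omega⟩
  intro t _
  simp only [show m + 2 - 1 = m + 1 from rfl, show m + 2 - 2 = m from rfl] at hH ⊢
  have hδc : (δ : ℂ) ≠ 0 := by exact_mod_cast hδ.ne'
  have hdc : (δ : ℂ) - δ₁ ≠ 0 := by
    rw [sub_ne_zero]; exact_mod_cast hδne
  have hlc := lgamC_cont m
  -- derivative of R
  have hRd : ∀ x : ℝ, HasDerivAt R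
      (1 / (α : ℂ) - ∑ r : Fin M, A r * sr r * Complex.exp (-(sr r * (x : ℂ)))) x := by
    intro x
    have hRf : R = fun x : ℝ => (x : ℂ) / (α : ℂ) -
        ∑ r : Fin M, A r * (1 - Complex.exp (-(sr r * (x : ℂ)))) := by
      funext y; rw [hR y]; push_cast; rfl
    rw [hRf]
    refine HasDerivAt.sub ((Complex.ofRealCLM.hasDerivAt (x := x)).div_const (α : ℂ)) ?_
    refine HasDerivAt.fun_sum fun r _ => ?_
    refine (((exp_comp_deriv (sr r) x).const_sub 1).const_mul (A r)).congr_deriv ?_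
    ring
  have hHc : ∀ x : ℝ, ((H (t - x) : ℝ) : ℂ) =
      lgamC (m + 1) ((δ : ℂ) * ((t : ℂ) - (x : ℂ))) / (Nat.factorial m : ℂ) -
      ((δ : ℂ) / ((δ : ℂ) - δ₁)) ^ (m + 1) *
        lgamC (m + 1) (((δ : ℂ) - δ₁) * ((t : ℂ) - (x : ℂ))) *
        Complex.exp (-((δ₁ : ℂ) * ((t : ℂ) - (x : ℂ)))) / (Nat.factorial m : ℂ) := by
    intro x
    rw [hH]
    push_cast [lgam_cast]
    rfl
  have hHcont : Continuous fun x : ℝ => ((H (t - x) : ℝ) : ℂ) := by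
    simp only [hHc]
    fun_prop
  have hK : ∀ b : ℂ, b ≠ δ →
      (∫ x in (0 : ℝ)..t, Complex.exp (-(b * (x : ℂ))) * ((H (t - x) : ℝ) : ℂ)) =
      phiAux (m + 1) (δ : ℂ) b (t : ℂ) / (Nat.factorial m : ℂ) -
        ((δ : ℂ) / ((δ : ℂ) - (δ₁ : ℂ))) ^ (m + 1) *
          phiAux (m + 1) ((δ : ℂ) - (δ₁ : ℂ)) (b - (δ₁ : ℂ)) (t : ℂ) *
          Complex.exp (-((δ₁ : ℂ) * (t : ℂ))) / (Nat.factorial m : ℂ) := by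
    intro b hb
    rw [← phi_int m δ b hδc hb.symm t,
      ← phi_int m (δ - δ₁) (b - δ₁) hdc (fun h => hb (sub_left_injective h).symm) t]
    have hi : ∀ x : ℝ, Complex.exp (-(b * (x : ℂ))) * ((H (t - x) : ℝ) : ℂ) =
        (1 / (Nat.factorial m : ℂ)) * (lgamC (m + 1) ((δ : ℂ) * ((t : ℂ) - (x : ℂ))) *
          Complex.exp (-(b * (x : ℂ)))) -
        (((δ : ℂ) / ((δ : ℂ) - (δ₁ : ℂ))) ^ (m + 1) *
          Complex.exp (-((δ₁ : ℂ) * (t : ℂ))) / (Nat.factorial m : ℂ)) *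
          (lgamC (m + 1) (((δ : ℂ) - δ₁) * ((t : ℂ) - (x : ℂ))) *
            Complex.exp (-((b - δ₁) * (x : ℂ)))) := by
      intro x
      rw [hHc]
      have e1 : Complex.exp (-((δ₁ : ℂ) * ((t : ℂ) - (x : ℂ)))) * Complex.exp (-(b * (x : ℂ)))
          = Complex.exp (-((δ₁ : ℂ) * (t : ℂ))) * Complex.exp (-((b - δ₁) * (x : ℂ))) := by
        rw [← Complex.exp_add, ← Complex.exp_add]; congr 1; ring
      linear_combination (-(((δ : ℂ) / ((δ : ℂ) - (δ₁ : ℂ))) ^ (m + 1) *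
        lgamC (m + 1) (((δ : ℂ) - δ₁) * ((t : ℂ) - (x : ℂ))) / (Nat.factorial m : ℂ))) * e1
    simp only [hi]
    rw [intervalIntegral.integral_sub, intervalIntegral.integral_const_mul,
      intervalIntegral.integral_const_mul]
    · ring
    · apply Continuous.intervalIntegrable; fun_prop
    · apply Continuous.intervalIntegrable; fun_prop
  have hsplit : ∀ x : ℝ, deriv R x * (((1 : ℝ) - H (t - x) : ℝ) : ℂ) =
      (1 / (α : ℂ) - ∑ r : Fin M, A r * sr r * Complex.exp (-(sr r * (x : ℂ)))) -
      ((1 / (α : ℂ)) * (Complex.exp (-(0 * (x : ℂ))) * ((H (t - x) : ℝ) : ℂ)) -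
        ∑ r : Fin M, A r * sr r *
          (Complex.exp (-(sr r * (x : ℂ))) * ((H (t - x) : ℝ) : ℂ))) := by
    intro x
    rw [(hRd x).deriv]
    simp only [← mul_assoc, ← Finset.sum_mul]
    push_cast
    simp only [zero_mul, neg_zero, Complex.exp_zero]
    ring
  simp only [hsplit]
  have hR0 : R 0 = 0 := by rw [hR]; simp
  rw [intervalIntegral.integral_sub,
    intervalIntegral.integral_eq_sub_of_hasDerivAt (fun x _ => hRd x),
    intervalIntegral.integral_sub,
    intervalIntegral.integral_const_mul, intervalIntegral.integral_finsetSum, hK 0 hδc.symm, hR0]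
  · simp only [intervalIntegral.integral_const_mul]
    rw [Finset.sum_congr rfl fun r _ => by rw [hK (sr r) (hneδ r)]]
    rw [zero_sub]
    ring
  all_goals first
    | (apply Continuous.intervalIntegrable; fun_prop)
    | (intro r _; apply Continuous.intervalIntegrable; fun_prop)
end

section
/- Fix an integer G ≥ 1 and positive reals k_on, k_off, k_1, …, k_G, δ_1, and let φ(s) = [k_1 (s + k_on) / (s² + s(k_1 + k_on + k_off) + k_1 k_on)] · ∏_{i=2}^G k_i/(s + k_i) and α = (k_on + k_off)/(k_on k_1) + Σ_{i=2}^G 1/k_i. Suppose p and q are coprime complex polynomials with φ(s)/(s(1 − φ(s))) = p(s)/q(s), where q(s) = s² ∏_{r=1}^M (s + s_r) for pairwise distinct nonzero complex numbers s_1, …, s_M with positive real part, none equal to δ_1, and set A_r = p(−s_r)/q'(−s_r) and R(x) = x/α − Σ_{r=1}^M A_r (1 − e^{−s_r x}). Let H(t) = 1 − e^{−δ_1 t}, B_1^* = (1/α)∫_0^∞ (1 − H(t)) dt, B_1(t) = ∫_0^t R'(x)(1 − H(t−x)) dx, B_2^* = (1/α)∫_0^∞ B_1(t)(1 − H(t))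 dt, and FF = 1 + 2 B_2^*/B_1^* − B_1^*. Then FF = 1 − Σ_{r=1}^M A_r s_r/(s_r + δ_1), and moreover, if φ(δ_1) ≠ 1, this value equals 1/(1 − φ(δ_1)) − 1/(α δ_1). -/
open Complex Polynomial MeasureTheory Set

lemma aux_int (c : ℂ) (hc : 0 < c.re) :
    IntegrableOn (fun t : ℝ => cexp (-(c * t))) (Ioi 0) ∧
      ∫ t in Ioi (0:ℝ), cexp (-(c * t)) = 1 / c := by
  have h : (-c).re < 0 := by simpa using hc
  have h1 := integrableOn_exp_mul_complex_Ioi h 0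
  have h2 := integral_exp_mul_complex_Ioi h 0
  simp only [neg_mul] at h1 h2
  refine ⟨h1, ?_⟩
  rw [h2]; simp

lemma aux_deriv_prod (s : Finset ℕ) (k : ℕ → ℝ) (hk : ∀ i ∈ s, 0 < k i) :
    (Polynomial.derivative (∏ i ∈ s, (X + C (k i : ℂ)))).eval 0 =
      (∏ i ∈ s, (k i : ℂ)) * ∑ i ∈ s, 1 / (k i : ℂ) := by
  induction s using Finset.induction_on with
  | empty => simp
  | insert a s ha ih =>
    have := ih (fun i hi => hk i (Finset.mem_insert_of_mem hi))
    have hka : (k a : ℂ) ≠ 0 := by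
      exact_mod_cast (hk a (Finset.mem_insert_self _ _)).ne'
    rw [Finset.prod_insert ha, Finset.prod_insert ha, Finset.sum_insert ha, derivative_mul]
    simp only [eval_add, eval_mul, this, derivative_add, derivative_X, derivative_C, eval_one,
      eval_X, eval_C, eval_prod, eval_zero, zero_add, add_zero, one_mul]
    field_simp

lemma aux_B1 (α δ t : ℝ) (hα : α ≠ 0) (hδ : δ ≠ 0) (M : ℕ) (sr A : Fin M → ℂ)
    (hne : ∀ r, sr r ≠ (δ : ℂ)) :
    ∫ x in (0:ℝ)..t, (1 / (α:ℂ) - ∑ r, A r * (sr r * cexp (-(sr r * x)))) *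
        cexp (-(δ * (t - x))) =
      (1 - cexp (-(δ * t))) / (α * δ) -
        ∑ r, A r * sr r / (δ - sr r) * (cexp (-(sr r * t)) - cexp (-(δ * t))) := by
  have hα' : (α:ℂ) ≠ 0 := by exact_mod_cast hα
  have hδ' : (δ:ℂ) ≠ 0 := by exact_mod_cast hδ
  have key : ∀ x ∈ uIcc (0:ℝ) t, HasDerivAt (fun x : ℝ =>
      cexp (-(δ * (t - x))) / (α * δ) -
        ∑ r, A r * sr r / (δ - sr r) * cexp (-(sr r * x) + -(δ * (t - x))))
      ((1 / (α:ℂ) - ∑ r, A r * (sr r * cexp (-(sr r * x)))) *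
        cexp (-(δ * (t - x)))) x := by
    intro x _
    have hx : HasDerivAt (fun x : ℝ => (x : ℂ)) 1 x := Complex.ofRealCLM.hasDerivAt
    have h1 : HasDerivAt (fun x : ℝ => -((δ:ℂ) * (t - x))) δ x := by
      have := ((hx.const_sub (t:ℂ)).const_mul (δ:ℂ)).neg
      exact this.congr_deriv (by simp)
    have h2 := (h1.cexp).div_const ((α:ℂ) * δ)
    have h3 : ∀ r ∈ (Finset.univ : Finset (Fin M)), HasDerivAt (fun x : ℝ =>
        A r * sr r / (δ - sr r) * cexp (-(sr r * x) + -(δ * (t - x))))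
        (A r * sr r / (δ - sr r) * (cexp (-(sr r * x) + -(δ * (t - x))) * (-(sr r * 1) + δ))) x :=
      fun r _ => (((hx.const_mul (sr r)).neg.add h1).cexp).const_mul _
    have h4 := h2.sub (HasDerivAt.fun_sum h3)
    refine h4.congr_deriv ?_
    symm
    rw [sub_mul, Finset.sum_mul]
    congr 1
    · field_simp
    · refine Finset.sum_congr rfl fun r _ => ?_
      have : (δ:ℂ) - sr r ≠ 0 := sub_ne_zero.2 (hne r).symm
      rw [Complex.exp_add]
      field_simp
      ring
  rw [intervalIntegral.integral_eq_sub_of_hasDerivAt key]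
  · simp only [sub_self, mul_zero, neg_zero, Complex.exp_zero, add_zero, ofReal_zero, sub_zero,
      zero_add, mul_sub, Finset.sum_sub_distrib]
    ring
  · apply Continuous.intervalIntegrable
    fun_prop

lemma aux_alg (G : ℕ) (hG : 1 ≤ G) (kon koff δ₁ : ℝ) (k : ℕ → ℝ)
    (hkon : 0 < kon) (hkoff : 0 < koff) (hδ₁ : 0 < δ₁)
    (hk : ∀ i ∈ Finset.Icc 1 G, 0 < k i)
    (φ : ℝ → ℝ)
    (hφ : ∀ s : ℝ, φ s =
      k 1 * (s + kon) / (s ^ 2 + s * (k 1 + kon + koff) + k 1 * kon) *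
        ∏ i ∈ Finset.Icc 2 G, k i / (s + k i))
    (α : ℝ) (hα : α = (kon + koff) / (kon * k 1) + ∑ i ∈ Finset.Icc 2 G, 1 / k i)
    (hα0 : 0 < α)
    (M : ℕ) (sr : Fin M → ℂ)
    (hdist : Function.Injective sr) (hne0 : ∀ r, sr r ≠ 0)
    (hre : ∀ r, 0 < (sr r).re)
    (p q : Polynomial ℂ)
    (hq : q = X ^ 2 * ∏ r : Fin M, (X + C (sr r)))
    (hratio : ∀ s : ℝ, 0 < s →
      ((φ s : ℂ)) / ((s : ℂ) * (1 - (φ s : ℂ))) = p.eval (s : ℂ) / q.eval (s : ℂ))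
    (A : Fin M → ℂ)
    (hA : ∀ r, A r = p.eval (-(sr r)) / (Polynomial.derivative q).eval (-(sr r))) :
    p = C (1 / (α:ℂ)) * ∏ r : Fin M, (X + C (sr r)) -
      X * ∑ r, C (A r * sr r) * ∏ j ∈ Finset.univ.erase r, (X + C (sr j)) := by
  have hk1 : 0 < k 1 := hk 1 (Finset.mem_Icc.2 ⟨le_rfl, hG⟩)
  have hk2 : ∀ i ∈ Finset.Icc 2 G, 0 < k i := fun i hi => hk i (by
    rw [Finset.mem_Icc] at *; omega)
  have hα' : (α:ℂ) ≠ 0 := by exact_mod_cast hα0.ne'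
  set P : ℂ[X] := ∏ r : Fin M, (X + C (sr r)) with hP
  set Z : ℂ[X] := ∏ i ∈ Finset.Icc 2 G, (X + C (k i : ℂ)) with hZ
  set K : ℂ := ∏ i ∈ Finset.Icc 2 G, (k i : ℂ) with hK
  have hK0 : K ≠ 0 := Finset.prod_ne_zero_iff.2 fun i hi => by exact_mod_cast (hk2 i hi).ne'
  set Qd : ℂ[X] := C 1 * X ^ 2 + C ((k 1 + kon + koff : ℝ) : ℂ) * X + C ((k 1 * kon : ℝ) : ℂ) with hQd
  set N : ℂ[X] := C ((k 1 : ℂ) * K) * (X + C (kon : ℂ)) with hN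
  have hPm : P.Monic := monic_prod_of_monic _ _ fun r _ => monic_X_add_C _
  have hZm : Z.Monic := monic_prod_of_monic _ _ fun r _ => monic_X_add_C _
  have hPd : P.natDegree = M := by
    rw [hP, natDegree_prod_of_monic _ _ (fun r _ => monic_X_add_C _)]; simp
  have hQdeg : Qd.natDegree = 2 := natDegree_quadratic one_ne_zero
  have hQm : Qd.Monic := by
    rw [Monic, hQd, leadingCoeff_quadratic one_ne_zero]
  have hDm : (Qd * Z).Monic := hQm.mul hZm
  have hDd : 2 ≤ (Qd * Z).natDegree := by rw [hQm.natDegree_mul hZm, hQdeg]; omega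
  have hNd : N.natDegree ≤ 1 := by
    rw [hN]
    refine (natDegree_C_mul_le _ _).trans ?_
    simp
  have hFd : 2 ≤ (Qd * Z - N).natDegree := by
    rw [natDegree_sub_eq_left_of_natDegree_lt (by omega)]; exact hDd
  -- main identity
  have main : N * q = X * (Qd * Z - N) * p := by
    refine Polynomial.eq_of_infinite_eval_eq _ _ ?_
    have hinf : ((fun x : ℝ => (x : ℂ)) '' Ioi (0:ℝ)).Infinite :=
      (Ioi_infinite (0:ℝ)).image Complex.ofReal_injective.injOn
    refine hinf.mono ?_
    rintro _ ⟨s, hs, rfl⟩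
    have hs : 0 < s := hs
    simp only [mem_setOf_eq, eval_mul]
    have hQpos : 0 < s ^ 2 + s * (k 1 + kon + koff) + k 1 * kon := by positivity
    have hφ1 : φ s < 1 := by
      rw [hφ]
      have h1 : k 1 * (s + kon) / (s ^ 2 + s * (k 1 + kon + koff) + k 1 * kon) < 1 := by
        rw [div_lt_one hQpos]; nlinarith [mul_pos hs hkon, mul_pos hs hkoff, mul_pos hs hs]
      have h2 : ∏ i ∈ Finset.Icc 2 G, k i / (s + k i) ≤ 1 := by
        refine Finset.prod_le_one (fun i hi => ?_) (fun i hi => ?_)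
        · have := hk2 i hi; positivity
        · have := hk2 i hi; rw [div_le_one (by positivity)]; linarith
      have h3 : 0 ≤ k 1 * (s + kon) / (s ^ 2 + s * (k 1 + kon + koff) + k 1 * kon) := by positivity
      nlinarith
    have hφ1' : (1:ℂ) - φ s ≠ 0 := by
      have : (1:ℝ) - φ s ≠ 0 := by linarith
      exact_mod_cast this
    have hs' : (s:ℂ) ≠ 0 := by exact_mod_cast hs.ne'
    have hq0 : q.eval (s:ℂ) ≠ 0 := by
      rw [hq, hP]
      simp only [eval_mul, eval_pow, eval_X, eval_prod, eval_add, eval_C]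
      refine mul_ne_zero (pow_ne_zero _ hs') (Finset.prod_ne_zero_iff.2 fun r _ h => ?_)
      have := congrArg Complex.re h
      simp at this
      linarith [hre r]
    have hZ0 : Z.eval (s:ℂ) ≠ 0 := by
      rw [hZ]
      simp only [eval_prod, eval_add, eval_X, eval_C]
      refine Finset.prod_ne_zero_iff.2 fun i hi => ?_
      have : s + k i ≠ 0 := by linarith [hk2 i hi]
      exact_mod_cast this
    have hQe : Qd.eval (s:ℂ) = ((s ^ 2 + s * (k 1 + kon + koff) + k 1 * kon : ℝ) : ℂ) := by
      rw [hQd]; simp; ring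
    have hQ0 : Qd.eval (s:ℂ) ≠ 0 := by rw [hQe]; exact_mod_cast hQpos.ne'
    have hφe : (φ s : ℂ) * (Qd.eval (s:ℂ) * Z.eval (s:ℂ)) = N.eval (s:ℂ) := by
      have : (φ s : ℂ) = (k 1 * (s + kon) : ℂ) / Qd.eval (s:ℂ) * (K / Z.eval (s:ℂ)) := by
        rw [hφ, hQe, hZ, hK]
        simp only [eval_prod, eval_add, eval_X, eval_C]
        rw [← Finset.prod_div_distrib]
        push_cast
        rfl
      rw [this, hN]
      simp only [eval_mul, eval_add, eval_X, eval_C]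
      field_simp
    have h := hratio s hs
    rw [div_eq_div_iff (mul_ne_zero hs' hφ1') hq0] at h
    simp only [eval_sub, eval_mul, eval_X]
    rw [← hφe]
    linear_combination (Qd.eval (s:ℂ) * Z.eval (s:ℂ)) * h
  -- degree
  have hpd : p.natDegree ≤ M := by
    by_cases hp : p = 0
    · simp [hp]
    have hF0 : Qd * Z - N ≠ 0 := by rintro h; rw [h] at hFd; simp at hFd
    have h1 := congrArg natDegree main
    rw [natDegree_mul (mul_ne_zero X_ne_zero hF0) hp, natDegree_mul X_ne_zero hF0, natDegree_X] at h1
    have h2 : (N * q).natDegree ≤ 1 + (2 + M) := by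
      refine natDegree_mul_le.trans (add_le_add hNd ?_)
      rw [hq]
      refine natDegree_mul_le.trans (add_le_add ?_ hPd.le)
      simp
    omega
  -- value at 0
  have hp0 : p.eval 0 = 1 / (α:ℂ) * P.eval 0 := by
    have hkon' : (kon:ℂ) ≠ 0 := by exact_mod_cast hkon.ne'
    have hk1' : (k 1:ℂ) ≠ 0 := by exact_mod_cast hk1.ne'
    have hZ0 : Z.eval 0 = K := by rw [hZ, hK]; simp [eval_prod]
    have hF0 : (Qd * Z - N).eval 0 = 0 := by
      simp only [eval_sub, eval_mul, hZ0, hQd, hN, eval_add, eval_X, eval_C, eval_pow]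
      push_cast; ring
    have hF1 : (derivative (Qd * Z - N)).eval 0 = α * ((k 1:ℂ) * K * kon) := by
      have := aux_deriv_prod _ k hk2
      rw [derivative_sub, derivative_mul, eval_sub, eval_add, eval_mul, eval_mul, hZ0, this, hα,
        hQd, hN]
      simp
      field_simp
      ring
    obtain ⟨E, hE⟩ : X ∣ (Qd * Z - N) := by
      rw [X_dvd_iff, coeff_zero_eq_eval_zero]; exact hF0
    have hE0 : E.eval 0 = α * ((k 1:ℂ) * K * kon) := by
      rw [← hF1, hE]; simp [derivative_mul]
    have hNP : N * P = E * p := by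
      have : (X:ℂ[X]) ^ 2 ≠ 0 := pow_ne_zero _ X_ne_zero
      apply mul_left_cancel₀ this
      rw [hE, hq] at main
      linear_combination main
    have h := congrArg (eval 0) hNP
    rw [eval_mul, eval_mul (p := E), hE0, hN] at h
    simp only [eval_mul, eval_add, eval_X, eval_C, zero_add] at h
    have h5 : (k 1:ℂ) * K * kon ≠ 0 := mul_ne_zero (mul_ne_zero hk1' hK0) hkon'
    field_simp
    apply mul_left_cancel₀ h5
    linear_combination -h
  rw [← sub_eq_zero]
  refine eq_zero_of_natDegree_lt_card_of_eval_eq_zero (ι := Option (Fin M)) _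
    (f := fun o => o.elim 0 (fun r => - sr r)) ?_ ?_ ?_
  · rintro (_|a) (_|b) h
    · rfl
    · exact absurd (by simpa using h) (hne0 b)
    · exact absurd (by simpa using h) (hne0 a)
    · simp at h; rw [hdist h]
  · rintro (_|a)
    · simp [hp0]
    · have hPa : P = (X + C (sr a)) * ∏ j ∈ Finset.univ.erase a, (X + C (sr j)) := by
        exact (Finset.mul_prod_erase Finset.univ (fun r => X + C (sr r)) (Finset.mem_univ a)).symm
      set W : ℂ[X] := ∏ j ∈ Finset.univ.erase a, (X + C (sr j)) with hW
      have hW0 : W.eval (-sr a) ≠ 0 := by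
        rw [hW]
        simp only [eval_prod, eval_add, eval_X, eval_C]
        refine Finset.prod_ne_zero_iff.2 fun j hj h => ?_
        exact (Finset.mem_erase.1 hj).1 (hdist (by linear_combination h))
      have hqa : (derivative q).eval (-sr a) = (sr a) ^ 2 * W.eval (-sr a) := by
        rw [hq, hPa]; simp [derivative_mul]
      have hsum : eval (-sr a) (∑ r, C (A r * sr r) * ∏ j ∈ Finset.univ.erase r, (X + C (sr j)))
          = A a * sr a * W.eval (-sr a) := by
        rw [eval_finsetSum, Finset.sum_eq_single a]
        · simp [hW]
        · intro b _ hb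
          rw [eval_mul, eval_prod, Finset.prod_eq_zero (i := a)]
          · simp
          · simp [hb.symm]
          · simp
        · simp
      have hPe : P.eval (-sr a) = 0 := by rw [hPa]; simp
      simp only [Option.elim, eval_sub, eval_mul, hPe, hsum, eval_X, hA a, hqa]
      have := hne0 a
      field_simp
      ring
  · rw [Fintype.card_option, Fintype.card_fin, Nat.lt_succ_iff]
    refine (natDegree_sub_le _ _).trans (max_le hpd ((natDegree_sub_le _ _).trans (max_le ?_ ?_)))
    · exact (natDegree_C_mul_le _ _).trans hPd.le
    · rw [Finset.mul_sum]
      refine natDegree_sum_le_of_forall_le _ _ fun r _ => ?_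
      have hM : 0 < M := r.pos
      refine natDegree_mul_le.trans ?_
      have h1 : (C (A r * sr r) * ∏ j ∈ Finset.univ.erase r, (X + C (sr j))).natDegree ≤ M - 1 := by
        refine (natDegree_C_mul_le _ _).trans ?_
        rw [natDegree_prod_of_monic _ _ (fun r _ => monic_X_add_C _)]; simp
      rw [natDegree_X]; omega

/-- Fano factor of total nuclear mRNA for `S = 1` nuclear
processing stage (exponential service with rate `δ₁`). -/
theorem fano_factor_nuclear_S1
    (G : ℕ) (hG : 1 ≤ G) (kon koff δ₁ : ℝ) (k : ℕ → ℝ)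
    (hkon : 0 < kon) (hkoff : 0 < koff) (hδ₁ : 0 < δ₁)
    (hk : ∀ i ∈ Finset.Icc 1 G, 0 < k i)
    (φ : ℝ → ℝ)
    (hφ : ∀ s : ℝ, φ s =
      k 1 * (s + kon) / (s ^ 2 + s * (k 1 + kon + koff) + k 1 * kon) *
        ∏ i ∈ Finset.Icc 2 G, k i / (s + k i))
    (α : ℝ) (hα : α = (kon + koff) / (kon * k 1) + ∑ i ∈ Finset.Icc 2 G, 1 / k i)
    (M : ℕ) (sr : Fin M → ℂ)
    (hdist : Function.Injective sr) (hne0 : ∀ r, sr r ≠ 0)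
    (hre : ∀ r, 0 < (sr r).re) (hneδ₁ : ∀ r, sr r ≠ (δ₁ : ℂ))
    (p q : Polynomial ℂ) (hcop : IsCoprime p q)
    (hq : q = X ^ 2 * ∏ r : Fin M, (X + C (sr r)))
    (hratio : ∀ s : ℝ, 0 < s →
      ((φ s : ℂ)) / ((s : ℂ) * (1 - (φ s : ℂ))) = p.eval (s : ℂ) / q.eval (s : ℂ))
    (A : Fin M → ℂ)
    (hA : ∀ r, A r = p.eval (-(sr r)) / (Polynomial.derivative q).eval (-(sr r)))
    (R : ℝ → ℂ)
    (hR : ∀ x : ℝ, R x = ((x / α : ℝ) : ℂ) -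
      ∑ r : Fin M, A r * (1 - Complex.exp (-(sr r * (x : ℂ)))))
    (H : ℝ → ℝ) (hH : ∀ t : ℝ, H t = 1 - Real.exp (-(δ₁ * t)))
    (B1s : ℝ) (hB1s : B1s = (1 / α) * ∫ t in Ioi (0 : ℝ), (1 - H t))
    (B1 : ℝ → ℂ)
    (hB1 : ∀ t : ℝ, B1 t = ∫ x in (0 : ℝ)..t, deriv R x * (((1 : ℝ) - H (t - x) : ℝ) : ℂ))
    (B2s : ℂ)
    (hB2s : B2s = (1 / (α : ℂ)) * ∫ t in Ioi (0 : ℝ), B1 t * (((1 : ℝ) - H t : ℝ) : ℂ))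
    (FF : ℂ) (hFF : FF = 1 + 2 * B2s / (B1s : ℂ) - (B1s : ℂ)) :
    FF = 1 - ∑ r : Fin M, A r * sr r / (sr r + (δ₁ : ℂ)) ∧
      (φ δ₁ ≠ 1 →
        FF = 1 / (1 - (φ δ₁ : ℂ)) - 1 / ((α : ℂ) * (δ₁ : ℂ))) := by
  have hk1 : 0 < k 1 := hk 1 (Finset.mem_Icc.2 ⟨le_rfl, hG⟩)
  have hα0 : 0 < α := by
    rw [hα]
    refine add_pos_of_pos_of_nonneg (by positivity) (Finset.sum_nonneg fun i hi => ?_)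
    have := hk i (by rw [Finset.mem_Icc] at *; omega)
    positivity
  have hα' : (α:ℂ) ≠ 0 := by exact_mod_cast hα0.ne'
  have hδ' : (δ₁:ℂ) ≠ 0 := by exact_mod_cast hδ₁.ne'
  have hsδ : ∀ r, sr r + (δ₁:ℂ) ≠ 0 := fun r h => by
    have := congrArg Complex.re h
    simp at this
    linarith [hre r]
  have hB1s' : (B1s : ℂ) = 1 / (α * δ₁) := by
    have h := (aux_int (δ₁:ℂ) (by simpa using hδ₁)).2
    have h' : ∫ t in Ioi (0:ℝ), (1 - H t) = 1 / δ₁ := by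
      apply Complex.ofReal_injective
      rw [← integral_complex_ofReal]
      simp only [hH]
      push_cast
      simpa using h
    rw [hB1s, h']
    push_cast
    field_simp
  have hdR : ∀ x : ℝ, deriv R x = 1 / (α:ℂ) - ∑ r, A r * (sr r * cexp (-(sr r * x))) := by
    intro x
    have hx : HasDerivAt (fun x : ℝ => (x : ℂ)) 1 x := Complex.ofRealCLM.hasDerivAt
    have h3 : ∀ r ∈ (Finset.univ : Finset (Fin M)), HasDerivAt (fun x : ℝ =>
        A r * (1 - cexp (-(sr r * x))))
        (A r * -(cexp (-(sr r * x)) * (-(sr r * 1)))) x :=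
      fun r _ => (((hx.const_mul (sr r)).neg.cexp).const_sub 1).const_mul _
    have h4 := (hx.div_const (α:ℂ)).sub (HasDerivAt.fun_sum h3)
    have hRe : R = fun x : ℝ => (x:ℂ) / α - ∑ r : Fin M, A r * (1 - cexp (-(sr r * (x : ℂ)))) := by
      funext x; rw [hR]; push_cast; rfl
    rw [hRe]
    refine h4.deriv.trans ?_
    congr 1
    refine Finset.sum_congr rfl fun r _ => ?_
    ring
  have hB1' : ∀ t : ℝ, B1 t * (((1 : ℝ) - H t : ℝ) : ℂ) =
      1 / (α * δ₁) * (cexp (-((δ₁:ℂ) * t)) - cexp (-((2 * δ₁ : ℂ) * t))) -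
        ∑ r, A r * sr r / (δ₁ - sr r) *
          (cexp (-((sr r + δ₁) * t)) - cexp (-((2 * δ₁ : ℂ) * t))) := by
    intro t
    have h := aux_B1 α δ₁ t hα0.ne' hδ₁.ne' M sr A hneδ₁
    have h1 : B1 t = (1 - cexp (-(δ₁ * t))) / (α * δ₁) -
        ∑ r, A r * sr r / (δ₁ - sr r) * (cexp (-(sr r * t)) - cexp (-(δ₁ * t))) := by
      rw [← h, hB1]
      refine intervalIntegral.integral_congr fun x _ => ?_
      simp only [hdR, hH]
      push_cast
      simp
    have e2 : cexp (-((2 * δ₁ : ℂ) * t)) = cexp (-((δ₁:ℂ) * t)) * cexp (-((δ₁:ℂ) * t)) := by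
      rw [← Complex.exp_add]; ring_nf
    have e3 : ∀ r, cexp (-((sr r + δ₁) * t)) = cexp (-(sr r * t)) * cexp (-((δ₁:ℂ) * t)) := by
      intro r
      rw [← Complex.exp_add]; ring_nf
    have e4 : (((1 : ℝ) - H t : ℝ) : ℂ) = cexp (-((δ₁:ℂ) * t)) := by
      rw [hH]; push_cast; ring
    rw [h1, e4, e2, sub_mul, Finset.sum_mul]
    congr 1
    · ring
    · refine Finset.sum_congr rfl fun r _ => ?_
      rw [e3]; ring
  have hB2 : B2s = 1 / (α:ℂ) * (1 / (2 * α * δ₁ ^ 2) -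
      ∑ r, A r * sr r / (2 * δ₁ * (sr r + δ₁))) := by
    rw [hB2s]
    congr 1
    simp only [hB1']
    have i1 := aux_int (δ₁:ℂ) (by simpa using hδ₁)
    have i2 := aux_int (2 * δ₁:ℂ) (by simpa using hδ₁)
    have i3 := fun r => aux_int (sr r + δ₁:ℂ) (by
      have := hre r
      simp only [add_re, ofReal_re]; positivity)
    have j : ∀ r ∈ (Finset.univ : Finset (Fin M)), IntegrableOn (fun t : ℝ =>
        A r * sr r / (δ₁ - sr r) *
          (cexp (-((sr r + δ₁) * t)) - cexp (-((2 * δ₁ : ℂ) * t)))) (Ioi 0) :=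
      fun r _ => ((i3 r).1.sub i2.1).const_mul _
    have j0 : IntegrableOn (fun t : ℝ => 1 / ((α:ℂ) * δ₁) *
        (cexp (-((δ₁:ℂ) * t)) - cexp (-((2 * δ₁ : ℂ) * t)))) (Ioi 0) :=
      (i1.1.sub i2.1).const_mul _
    rw [integral_sub j0 (integrable_finsetSum _ j),
      integral_finsetSum _ j, integral_const_mul, integral_sub i1.1 i2.1, i1.2, i2.2]
    congr 1
    · field_simp
      ring
    · refine Finset.sum_congr rfl fun r _ => ?_
      rw [integral_const_mul, integral_sub (i3 r).1 i2.1, (i3 r).2, i2.2]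
      have h1 := hsδ r
      have h2 : (δ₁:ℂ) - sr r ≠ 0 := sub_ne_zero.2 (hneδ₁ r).symm
      field_simp
      ring
  have hsumEq : ∑ r, A r * sr r / (2 * δ₁ * (sr r + δ₁)) =
      1 / (2 * (δ₁:ℂ)) * ∑ r, A r * sr r / (sr r + δ₁) := by
    rw [Finset.mul_sum]
    refine Finset.sum_congr rfl fun r _ => ?_
    have h1 := hsδ r
    field_simp
  have first : FF = 1 - ∑ r : Fin M, A r * sr r / (sr r + (δ₁ : ℂ)) := by
    rw [hFF, hB2, hB1s', hsumEq]
    field_simp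
    ring
  refine ⟨first, fun hφ1 => ?_⟩
  have hp := aux_alg G hG kon koff δ₁ k hkon hkoff hδ₁ hk φ hφ α hα hα0 M sr hdist hne0 hre p q hq
    hratio A hA
  have h := hratio δ₁ hδ₁
  have hφ1' : (1:ℂ) - φ δ₁ ≠ 0 := by
    have : (1:ℝ) - φ δ₁ ≠ 0 := sub_ne_zero.2 hφ1.symm
    exact_mod_cast this
  set Pv : ℂ := ∏ r, ((δ₁:ℂ) + sr r) with hPv
  have hPv0 : Pv ≠ 0 := Finset.prod_ne_zero_iff.2 fun r _ => by rw [add_comm]; exact hsδ r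
  have hpe : p.eval (δ₁:ℂ) = Pv * (1 / α - δ₁ * ∑ r, A r * sr r / (sr r + δ₁)) := by
    rw [hp]
    simp only [eval_sub, eval_mul, eval_C, eval_X, eval_prod, eval_add, eval_finsetSum]
    rw [mul_sub, mul_left_comm Pv, Finset.mul_sum Finset.univ _ Pv]
    congr 1
    · ring
    · congr 1
      refine Finset.sum_congr rfl fun r _ => ?_
      have h1 := hsδ r
      rw [hPv, ← Finset.mul_prod_erase _ _ (Finset.mem_univ r)]
      field_simp
      ring
  have hqe : q.eval (δ₁:ℂ) = δ₁ ^ 2 * Pv := by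
    rw [hq]; simp [eval_prod, hPv]
  rw [hpe, hqe] at h
  rw [first]
  generalize ∑ r, A r * sr r / (sr r + (δ₁:ℂ)) = S at *
  field_simp at h ⊢
  linear_combination -h
end

section
/- Fix an integer G ≥ 1 and a real k > 0, and set φ(s) = (k/(s+k))^G and α = G/k. For a real T ≥ 0 define P(0, T) = (e^{−kT}/G) Σ_{j=0}^{G−1} (G−j)(kT)^j/j!, and for an integer m ≥ 1 define P(m, T) = (e^{−kT}/G) [ Σ_{j=0}^{G(m+1)−1} (G(m+1)−j)(kT)^j/j! − 2 Σ_{j=0}^{Gm−1} (Gm−j)(kT)^j/j! + Σ_{j=0}^{G(m−1)−1} (G(m−1)−j)(kT)^j/j! ]. Then for every real s > 0: ∫_0^∞ P(0, T) e^{−sT} dT = (α s − 1 + φ(s))/(α s²), and for every integer m ≥ 1, ∫_0^∞ P(m, T) e^{−sT} dT = (1 − φ(s))² φ(s)^{m−1}/(α s²). -/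
open Real Set MeasureTheory

lemma aux_term (k s : ℝ) (hk : 0 < k) (hs : 0 < s) (j : ℕ) :
    IntegrableOn (fun T : ℝ => T ^ j * Real.exp (-((s + k) * T))) (Ioi 0) ∧
    ∫ T in Ioi (0 : ℝ), T ^ j * Real.exp (-((s + k) * T)) =
      (Nat.factorial j : ℝ) / (s + k) ^ (j + 1) := by
  have hsk : 0 < s + k := by positivity
  constructor
  · have h := integrableOn_rpow_mul_exp_neg_mul_rpow (p := 1) (s := (j : ℝ)) (b := s + k)
      (by have : (0 : ℝ) ≤ j := j.cast_nonneg
          linarith) one_pos hsk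
    simpa only [Real.rpow_natCast, Real.rpow_one, neg_mul] using h
  · have h := Real.integral_rpow_mul_exp_neg_mul_Ioi (a := (j : ℝ) + 1) (r := s + k)
      (by positivity) hsk
    have e : ((j : ℝ) + 1) = ((j + 1 : ℕ) : ℝ) := by push_cast; ring
    rw [Real.Gamma_nat_eq_factorial, e, Real.rpow_natCast] at h
    simp only [Nat.cast_add, Nat.cast_one, add_sub_cancel_right, Real.rpow_natCast] at h
    rw [h, one_div, inv_pow]
    field_simp

lemma aux_sum (k s : ℝ) (hk : 0 < k) (hs : 0 < s) (N : ℕ) :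
    ∑ j ∈ Finset.range N, ((N : ℝ) - j) * ((k / (s + k)) ^ j / (s + k)) =
      (N * s - k + k * (k / (s + k)) ^ N) / s ^ 2 := by
  have hsk : s + k ≠ 0 := by positivity
  have g : ∀ N : ℕ, ∑ j ∈ Finset.range N, ((k / (s + k)) ^ j / (s + k)) =
      (1 - (k / (s + k)) ^ N) / s := by
    intro N
    induction N with
    | zero => simp
    | succ n ih =>
      rw [Finset.sum_range_succ, ih, pow_succ]
      generalize (k / (s + k)) ^ n = x
      field_simp
      ring
  induction N with
  | zero => simp
  | succ n ih =>
    have : ∑ j ∈ Finset.range (n + 1), (((n + 1 : ℕ) : ℝ) - j) * ((k / (s + k)) ^ j / (s + k)) =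
      ∑ j ∈ Finset.range n, ((n : ℝ) - j) * ((k / (s + k)) ^ j / (s + k)) +
      ∑ j ∈ Finset.range (n + 1), ((k / (s + k)) ^ j / (s + k)) := by
      rw [Finset.sum_range_succ, Finset.sum_range_succ _ n, ← add_assoc, ← Finset.sum_add_distrib]
      congr 1
      · apply Finset.sum_congr rfl
        intro j _
        push_cast
        ring
      · push_cast
        ring
    rw [this, ih, g, pow_succ (k / (s + k)) n]
    generalize (k / (s + k)) ^ n = x
    push_cast
    field_simp
    ring

lemma aux_int_s6 {f g h : ℝ → ℝ} {μ : Measure ℝ} (hf : Integrable f μ) (hg : Integrable g μ)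
    (hh : Integrable h μ) : ∫ x, (f x - 2 * g x + h x) ∂μ =
      ∫ x, f x ∂μ - 2 * ∫ x, g x ∂μ + ∫ x, h x ∂μ := by
  have a : Integrable (fun x => 2 * g x) μ := hg.const_mul 2
  have b : Integrable (fun x => f x - 2 * g x) μ := hf.sub a
  rw [integral_add b hh, integral_sub hf a, integral_const_mul]

lemma aux_F (k s : ℝ) (hk : 0 < k) (hs : 0 < s) (N : ℕ) :
    IntegrableOn (fun T : ℝ => Real.exp (-((s + k) * T)) *
      ∑ j ∈ Finset.range N, ((N : ℝ) - j) * (k * T) ^ j / (Nat.factorial j : ℝ)) (Ioi 0) ∧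
    ∫ T in Ioi (0 : ℝ), Real.exp (-((s + k) * T)) *
      ∑ j ∈ Finset.range N, ((N : ℝ) - j) * (k * T) ^ j / (Nat.factorial j : ℝ) =
      (N * s - k + k * (k / (s + k)) ^ N) / s ^ 2 := by
  have hsk : s + k ≠ 0 := by positivity
  have e : (fun T : ℝ => Real.exp (-((s + k) * T)) *
      ∑ j ∈ Finset.range N, ((N : ℝ) - j) * (k * T) ^ j / (Nat.factorial j : ℝ)) =
      fun T : ℝ => ∑ j ∈ Finset.range N, (((N : ℝ) - j) * k ^ j / (Nat.factorial j : ℝ)) *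
        (T ^ j * Real.exp (-((s + k) * T))) := by
    funext T
    rw [Finset.mul_sum]
    apply Finset.sum_congr rfl
    intro j _
    rw [mul_pow]
    ring
  have hi : ∀ j ∈ Finset.range N, Integrable (fun T : ℝ =>
      (((N : ℝ) - j) * k ^ j / (Nat.factorial j : ℝ)) *
        (T ^ j * Real.exp (-((s + k) * T)))) (volume.restrict (Ioi 0)) := fun j _ =>
    Integrable.const_mul (aux_term k s hk hs j).1 _
  rw [e]
  refine ⟨integrable_finsetSum _ hi, ?_⟩
  rw [integral_finsetSum _ hi, ← aux_sum k s hk hs]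
  apply Finset.sum_congr rfl
  intro j _
  rw [integral_const_mul, (aux_term k s hk hs j).2]
  have := Nat.factorial_ne_zero j
  rw [div_pow, pow_succ]
  field_simp

/-- Laplace transforms (in the processing time `T`) of the
steady-state distribution of the number of molecules in the delay model with
Erlang(G, k) interarrival times. -/
theorem laplace_transform_delay_distribution
    (G : ℕ) (hG : 1 ≤ G) (k : ℝ) (hk : 0 < k)
    (φ : ℝ → ℝ) (hφ : ∀ s : ℝ, φ s = (k / (s + k)) ^ G)
    (α : ℝ) (hα : α = G / k)
    (P : ℕ → ℝ → ℝ)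
    (hP0 : ∀ T : ℝ, 0 ≤ T → P 0 T =
      Real.exp (-(k * T)) / G *
        ∑ j ∈ Finset.range G, ((G : ℝ) - (j : ℝ)) * (k * T) ^ j / (Nat.factorial j : ℝ))
    (hPm : ∀ m : ℕ, 1 ≤ m → ∀ T : ℝ, 0 ≤ T → P m T =
      Real.exp (-(k * T)) / G *
        (∑ j ∈ Finset.range (G * (m + 1)),
            ((G * (m + 1) : ℕ) - (j : ℝ)) * (k * T) ^ j / (Nat.factorial j : ℝ)
          - 2 * ∑ j ∈ Finset.range (G * m),
            ((G * m : ℕ) - (j : ℝ)) * (k * T) ^ j / (Nat.factorial j : ℝ)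
          + ∑ j ∈ Finset.range (G * (m - 1)),
            ((G * (m - 1) : ℕ) - (j : ℝ)) * (k * T) ^ j / (Nat.factorial j : ℝ))) :
    ∀ s : ℝ, 0 < s →
      (∫ T in Ioi (0 : ℝ), P 0 T * Real.exp (-(s * T)) =
        (α * s - 1 + φ s) / (α * s ^ 2)) ∧
      (∀ m : ℕ, 1 ≤ m →
        ∫ T in Ioi (0 : ℝ), P m T * Real.exp (-(s * T)) =
          (1 - φ s) ^ 2 * (φ s) ^ (m - 1) / (α * s ^ 2)) := by
  intro s hs
  have hG0 : (G : ℝ) ≠ 0 := by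
    have : G ≠ 0 := by omega
    exact_mod_cast this
  have hx : ∀ T : ℝ, Real.exp (-((s + k) * T)) = Real.exp (-(k * T)) * Real.exp (-(s * T)) := by
    intro T
    rw [← Real.exp_add]
    congr 1
    ring
  constructor
  · have e : ∫ T in Ioi (0 : ℝ), P 0 T * Real.exp (-(s * T)) =
        ∫ T in Ioi (0 : ℝ), (1 / (G : ℝ)) * (Real.exp (-((s + k) * T)) *
      ∑ j ∈ Finset.range G, ((G : ℝ) - j) * (k * T) ^ j / (Nat.factorial j : ℝ)) := by
      apply setIntegral_congr_fun measurableSet_Ioi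
      intro T hT
      simp only
      rw [hP0 T (le_of_lt hT), hx]
      ring
    rw [e, integral_const_mul, (aux_F k s hk hs G).2, hφ, hα]
    generalize (k / (s + k)) ^ G = x
    field_simp
  · intro m hm
    obtain ⟨n, rfl⟩ : ∃ n, m = n + 1 := ⟨m - 1, by omega⟩
    obtain ⟨i1, h1⟩ := aux_F k s hk hs (G * (n + 1 + 1))
    obtain ⟨i2, h2⟩ := aux_F k s hk hs (G * (n + 1))
    obtain ⟨i3, h3⟩ := aux_F k s hk hs (G * (n + 1 - 1))
    have e : ∫ T in Ioi (0 : ℝ), P (n + 1) T * Real.exp (-(s * T)) =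
        ∫ T in Ioi (0 : ℝ), (1 / (G : ℝ)) * ((Real.exp (-((s + k) * T)) *
      ∑ j ∈ Finset.range (G * (n + 1 + 1)),
        (((G * (n + 1 + 1) : ℕ) : ℝ) - j) * (k * T) ^ j / (Nat.factorial j : ℝ)) -
      2 * (Real.exp (-((s + k) * T)) *
      ∑ j ∈ Finset.range (G * (n + 1)),
        (((G * (n + 1) : ℕ) : ℝ) - j) * (k * T) ^ j / (Nat.factorial j : ℝ)) +
      (Real.exp (-((s + k) * T)) *
      ∑ j ∈ Finset.range (G * (n + 1 - 1)),
        (((G * (n + 1 - 1) : ℕ) : ℝ) - j) * (k * T) ^ j / (Nat.factorial j : ℝ))) := by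
      apply setIntegral_congr_fun measurableSet_Ioi
      intro T hT
      simp only
      rw [hPm (n + 1) hm T (le_of_lt hT), hx]
      ring
    rw [e, integral_const_mul, aux_int_s6 i1 i2 i3, h1, h2, h3, hφ, hα]
    simp only [Nat.add_sub_cancel, pow_mul, pow_succ]
    generalize (k / (s + k)) ^ G = x
    generalize x ^ n = y
    push_cast
    field_simp
    ring
end

section
/- Fix integers G ≥ 2 and R ≥ 1 and positive reals k_on, k_1, …, k_G, and regard FF^C(R, k_off) as a function of k_off ≥ 0. (i) If e_{G−1}(k_2,…,k_G) − k_on e_{G−2}(k_2,…,k_G) ≤ 0, then FF^C(R, k_off) < 1 for every k_off ≥ 0. (ii) If e_{G−1}(k_2,…,k_G) − k_on e_{G−2}(k_2,…,k_G) > 0, then, setting k_off^* = k_on² e_{G−2}(k_1,…,k_G) / (e_{G−1}(k_2,…,k_G) − k_on e_{G−2}(k_2,…,k_G)), one has FF^C(R, k_off) < 1 for 0 ≤ k_off < k_off^*, FF^C(R, k_off^*) = 1, and FF^C(R, k_off) > 1 for k_off > k_off^*. (iii) Moreover, if k_1 = k_2 = … = k_G = k, then the condition in (ii) is equivalent to k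 > k_on (G−1), and in that case k_off^* = G(G−1) k_on² / (2(k − k_on(G−1))). -/
/-- Elementary symmetric polynomial of (integer) degree `g` in the variables
`x i` for `i ∈ s`, with the conventions `e_0 = 1` and `e_g = 0` for `g < 0`
or `g > card s`. -/
noncomputable def esymm (x : ℕ → ℝ) (s : Finset ℕ) (g : ℤ) : ℝ :=
  if 0 ≤ g then ∑ t ∈ s.powersetCard g.toNat, ∏ i ∈ t, x i else 0

/-- Double factorial: `dfact n = n!! = n(n−2)(n−4)⋯`, with `0!! = 1!! = 1`. -/
def dfact : ℕ → ℕ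
  | 0 => 1
  | 1 => 1
  | n + 2 => (n + 2) * dfact n

/-- Fano factor of total cytoplasmic mRNA from the slow-scale linear noise
approximation, with `R` cytoplasmic processing steps. -/
noncomputable def FFC (G : ℕ) (k : ℕ → ℝ) (kon koff : ℝ) (R : ℕ) : ℝ :=
  1 + 2 * esymm k (Finset.Icc 1 G) (G : ℤ) *
      (1 - (dfact (2 * R - 1) : ℝ) / (dfact (2 * R) : ℝ)) *
      (koff * esymm k (Finset.Icc 2 G) ((G : ℤ) - 1)
        - kon * koff * esymm k (Finset.Icc 2 G) ((G : ℤ) - 2)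
        - kon ^ 2 * esymm k (Finset.Icc 1 G) ((G : ℤ) - 2)) /
      (koff * esymm k (Finset.Icc 2 G) ((G : ℤ) - 1)
        + kon * esymm k (Finset.Icc 1 G) ((G : ℤ) - 1)) ^ 2

theorem esymm_pos_aux (x : ℕ → ℝ) (s : Finset ℕ) (g : ℕ) (hg : g ≤ s.card)
    (hx : ∀ i ∈ s, 0 < x i) : 0 < esymm x s (g : ℤ) := by
  unfold esymm
  rw [if_pos (by positivity), Int.toNat_natCast]
  apply Finset.sum_pos
  · intro t ht
    exact Finset.prod_pos fun i hi => hx i ((Finset.mem_powersetCard.1 ht).1 hi)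
  · exact Finset.powersetCard_nonempty.2 hg

theorem esymm_const_aux (x : ℕ → ℝ) (s : Finset ℕ) (g : ℕ) (c : ℝ)
    (hx : ∀ i ∈ s, x i = c) : esymm x s (g : ℤ) = (s.card.choose g : ℝ) * c ^ g := by
  unfold esymm
  rw [if_pos (by positivity), Int.toNat_natCast]
  rw [Finset.sum_congr rfl (g := fun _ => c ^ g), Finset.sum_const, Finset.card_powersetCard,
    nsmul_eq_mul]
  intro t ht
  obtain ⟨h1, h2⟩ := Finset.mem_powersetCard.1 ht
  rw [Finset.prod_congr rfl (g := fun _ => c) (fun i hi => hx i (h1 hi)), Finset.prod_const, h2]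

theorem dfact_lt_aux (r : ℕ) : 0 < dfact (2 * r + 1) ∧ dfact (2 * r + 1) < dfact (2 * r + 2) := by
  induction r with
  | zero => decide
  | succ r ih =>
    obtain ⟨h0, h1⟩ := ih
    have e1 : dfact (2 * (r + 1) + 1) = (2 * r + 3) * dfact (2 * r + 1) := rfl
    have e2 : dfact (2 * (r + 1) + 2) = (2 * r + 4) * dfact (2 * r + 2) := rfl
    rw [e1, e2]
    constructor
    · positivity
    · nlinarith

/-- transition between sub- and super-Poissonian noise of the cytoplasmic mRNA
Fano factor as the deactivation rate `koff` crosses the threshold `koff*`. -/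
theorem FFC_sub_super_poissonian_threshold
    (G R : ℕ) (hG : 2 ≤ G) (hR : 1 ≤ R)
    (kon : ℝ) (k : ℕ → ℝ) (hkon : 0 < kon)
    (hk : ∀ i ∈ Finset.Icc 1 G, 0 < k i) :
    -- (i)
    ((esymm k (Finset.Icc 2 G) ((G : ℤ) - 1)
        - kon * esymm k (Finset.Icc 2 G) ((G : ℤ) - 2) ≤ 0 →
      ∀ koff : ℝ, 0 ≤ koff → FFC G k kon koff R < 1)) ∧
    -- (ii)
    ((0 < esymm k (Finset.Icc 2 G) ((G : ℤ) - 1)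
        - kon * esymm k (Finset.Icc 2 G) ((G : ℤ) - 2) →
      ∀ koffstar : ℝ,
        koffstar = kon ^ 2 * esymm k (Finset.Icc 1 G) ((G : ℤ) - 2) /
          (esymm k (Finset.Icc 2 G) ((G : ℤ) - 1)
            - kon * esymm k (Finset.Icc 2 G) ((G : ℤ) - 2)) →
        (∀ koff : ℝ, 0 ≤ koff → koff < koffstar → FFC G k kon koff R < 1) ∧
        FFC G k kon koffstar R = 1 ∧
        (∀ koff : ℝ, koffstar < koff → 1 < FFC G k kon koff R))) ∧
    -- (iii)
    (∀ c : ℝ, (∀ i ∈ Finset.Icc 1 G, k i = c) →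
      ((0 < esymm k (Finset.Icc 2 G) ((G : ℤ) - 1)
          - kon * esymm k (Finset.Icc 2 G) ((G : ℤ) - 2) ↔
        kon * ((G : ℝ) - 1) < c) ∧
      (kon * ((G : ℝ) - 1) < c →
        kon ^ 2 * esymm k (Finset.Icc 1 G) ((G : ℤ) - 2) /
          (esymm k (Finset.Icc 2 G) ((G : ℤ) - 1)
            - kon * esymm k (Finset.Icc 2 G) ((G : ℤ) - 2)) =
          (G : ℝ) * ((G : ℝ) - 1) * kon ^ 2 / (2 * (c - kon * ((G : ℝ) - 1)))))) := by
  obtain ⟨n, rfl⟩ : ∃ n, G = n + 2 := ⟨G - 2, by omega⟩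
  obtain ⟨r, rfl⟩ : ∃ r, R = r + 1 := ⟨R - 1, by omega⟩
  have hsub : ∀ i ∈ Finset.Icc 2 (n + 2), i ∈ Finset.Icc 1 (n + 2) := by
    intro i hi
    rw [Finset.mem_Icc] at *
    omega
  have c1 : (((n + 2 : ℕ) : ℤ) - 1) = ((n + 1 : ℕ) : ℤ) := by push_cast; ring
  have c2 : (((n + 2 : ℕ) : ℤ) - 2) = (n : ℤ) := by push_cast; ring
  unfold FFC
  rw [c1, c2]
  have hP := esymm_pos_aux k (Finset.Icc 1 (n + 2)) (n + 2) (by simp) hk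
  have hA := esymm_pos_aux k (Finset.Icc 2 (n + 2)) (n + 1) (by simp)
    (fun i hi => hk i (hsub i hi))
  have hC := esymm_pos_aux k (Finset.Icc 1 (n + 2)) n (by simp) hk
  have hD := esymm_pos_aux k (Finset.Icc 1 (n + 2)) (n + 1) (by simp) hk
  have hF : 0 < 1 - (dfact (2 * (r + 1) - 1) : ℝ) / (dfact (2 * (r + 1)) : ℝ) := by
    obtain ⟨h0, h1⟩ := dfact_lt_aux r
    have e1 : 2 * (r + 1) - 1 = 2 * r + 1 := by omega
    have e2 : 2 * (r + 1) = 2 * r + 2 := by omega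
    rw [e1, e2, sub_pos, div_lt_one (by exact_mod_cast h0.trans h1)]
    exact_mod_cast h1
  refine ⟨?_, ?_, ?_⟩
  rotate_left 2
  · intro c hc
    have hc0 : 0 < c := by
      have h1 : 1 ∈ Finset.Icc 1 (n + 2) := by simp
      rw [← hc 1 h1]
      exact hk 1 h1
    have hcn : 0 < c ^ n := by positivity
    rw [esymm_const_aux k (Finset.Icc 2 (n + 2)) (n + 1) c (fun i hi => hc i (hsub i hi)),
      esymm_const_aux k (Finset.Icc 2 (n + 2)) n c (fun i hi => hc i (hsub i hi)),
      esymm_const_aux k (Finset.Icc 1 (n + 2)) n c hc]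
    have k1 : (Finset.Icc 2 (n + 2)).card = n + 1 := by simp
    have k2 : (Finset.Icc 1 (n + 2)).card = n + 2 := by simp
    have b2 : (((n + 2).choose n : ℕ) : ℝ) = (n + 2) * (n + 1) / 2 := by
      have : (n + 2).choose n = (n + 2).choose 2 := Nat.choose_symm_add
      rw [this, Nat.cast_choose_two]
      push_cast
      ring
    rw [k1, k2, b2, Nat.choose_self, Nat.choose_succ_self_right]
    have e : ((1 : ℕ) : ℝ) * c ^ (n + 1) - kon * (((n + 1 : ℕ) : ℝ) * c ^ n)
        = c ^ n * (c - kon * (((n + 2 : ℕ) : ℝ) - 1)) := by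
      push_cast
      ring
    rw [e]
    constructor
    · rw [mul_pos_iff_of_pos_left hcn, sub_pos]
    · intro h
      have h' := sub_pos.2 h
      rw [div_eq_div_iff (by positivity) (by positivity)]
      push_cast
      ring
  all_goals
    generalize esymm k (Finset.Icc 1 (n + 2)) ((n + 2 : ℕ) : ℤ) = P at *
    generalize esymm k (Finset.Icc 2 (n + 2)) ((n + 1 : ℕ) : ℤ) = A at *
    generalize esymm k (Finset.Icc 2 (n + 2)) (n : ℤ) = B at *
    generalize esymm k (Finset.Icc 1 (n + 2)) (n : ℤ) = C at *
    generalize esymm k (Finset.Icc 1 (n + 2)) ((n + 1 : ℕ) : ℤ) = D at *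
    generalize 1 - (dfact (2 * (r + 1) - 1) : ℝ) / (dfact (2 * (r + 1)) : ℝ) = F at *
    have hneg : ∀ koff : ℝ, 0 ≤ koff → koff * (A - kon * B) < kon ^ 2 * C →
        1 + 2 * P * F * (koff * A - kon * koff * B - kon ^ 2 * C) /
          (koff * A + kon * D) ^ 2 < 1 := by
      intro koff h0 h
      have : 2 * P * F * (koff * A - kon * koff * B - kon ^ 2 * C) /
          (koff * A + kon * D) ^ 2 < 0 := by
        apply div_neg_of_neg_of_pos
        · apply mul_neg_of_pos_of_neg (by positivity)
          linarith
        · positivity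
      linarith
    have hC' : 0 < kon ^ 2 * C := by positivity
  · intro h koff h0
    apply hneg koff h0
    have := mul_nonpos_of_nonneg_of_nonpos h0 h
    linarith
  · intro h s hs
    have hs0 : 0 < s := by rw [hs]; positivity
    have hs1 : s * (A - kon * B) = kon ^ 2 * C := by
      rw [hs]
      field_simp
    refine ⟨?_, ?_, ?_⟩
    · intro koff h0 h1
      apply hneg koff h0
      rw [← hs1]
      exact mul_lt_mul_of_pos_right h1 h
    · have : s * A - kon * s * B - kon ^ 2 * C = 0 := by linarith
      rw [this]
      simp
    · intro koff h1
      have h0 : 0 < koff := hs0.trans h1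
      have h2 := mul_lt_mul_of_pos_right h1 h
      have h3 : 0 < koff * A - kon * koff * B - kon ^ 2 * C := by linarith
      have : 0 < 2 * P * F * (koff * A - kon * koff * B - kon ^ 2 * C) /
          (koff * A + kon * D) ^ 2 := by positivity
      linarith
end

section
/- Fix integers G ≥ 2 and R ≥ 2 and positive reals k_on, k_1, …, k_G, λ, and a nonnegative real k_off. Let C be the R×R covariance matrix of cytoplasmic mRNA species defined in the Lyapunov-equation proposition (in particular, for i ≠ j, C_{i,j} = κ · 2^{2−i−j}(i+j−2)!/((i−1)!(j−1)!) · k_on e_G(k_1²,…,k_G²), where κ = (k_off e_{G−1}(k_2,…,k_G) − k_on k_off e_{G−2}(k_2,…,k_G) − k_on² e_{G−2}(k_1,…,k_G))/(λE³) and E = k_off e_{G−1}(k_2,…,k_G) + k_on e_{G−1}(k_1,…,k_G)). Then for all i ≠ j: if FF^C(R, k_off) > 1 then C_{i,j} > 0, and if FF^C(R, k_off) < 1 then C_{i,j} < 0. -/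
theorem aux_esymm_pos (x : ℕ → ℝ) (s : Finset ℕ) (g : ℤ) (h0 : 0 ≤ g) (hg : g ≤ s.card)
    (hx : ∀ i ∈ s, 0 < x i) : 0 < esymm x s g := by
  unfold esymm
  rw [if_pos h0]
  apply Finset.sum_pos
  · intro t ht
    apply Finset.prod_pos
    intro i hi
    exact hx i ((Finset.mem_powersetCard.1 ht).1 hi)
  · apply Finset.powersetCard_nonempty.2
    omega

theorem aux_esymm_nonneg (x : ℕ → ℝ) (s : Finset ℕ) (g : ℤ)
    (hx : ∀ i ∈ s, 0 < x i) : 0 ≤ esymm x s g := by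
  unfold esymm
  split_ifs
  · apply Finset.sum_nonneg
    intro t ht
    apply Finset.prod_nonneg
    intro i hi
    exact (hx i ((Finset.mem_powersetCard.1 ht).1 hi)).le
  · exact le_rfl

theorem aux_dfact_pos (n : ℕ) : 0 < dfact (2 * n) := by
  induction n with
  | zero => simp [dfact]
  | succ n ih =>
    rw [show 2 * (n + 1) = 2 * n + 2 by ring, dfact]
    positivity

theorem aux_dfact_lt (n : ℕ) : dfact (2 * n + 1) < dfact (2 * n + 2) := by
  induction n with
  | zero => simp [dfact]
  | succ n ih =>
    rw [show 2 * (n + 1) + 1 = (2 * n + 1) + 2 by ring,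
      show 2 * (n + 1) + 2 = (2 * n + 2) + 2 by ring, dfact, dfact.eq_3 (2 * n + 2)]
    nlinarith

/-- off-diagonal covariances of cytoplasmic mRNA species are
positive when the total cytoplasmic Fano factor is super-Poissonian and
negative when it is sub-Poissonian. -/
theorem offdiagonal_covariance_sign
    (G R : ℕ) (hG : 2 ≤ G) (hR : 2 ≤ R)
    (kon koff lam : ℝ) (k : ℕ → ℝ)
    (hkon : 0 < kon) (hkoff : 0 ≤ koff) (hlam : 0 < lam)
    (hk : ∀ i ∈ Finset.Icc 1 G, 0 < k i)
    (E κ : ℝ)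
    (hE : E = koff * esymm k (Finset.Icc 2 G) ((G : ℤ) - 1)
      + kon * esymm k (Finset.Icc 1 G) ((G : ℤ) - 1))
    (hκ : κ = (koff * esymm k (Finset.Icc 2 G) ((G : ℤ) - 1)
      - kon * koff * esymm k (Finset.Icc 2 G) ((G : ℤ) - 2)
      - kon ^ 2 * esymm k (Finset.Icc 1 G) ((G : ℤ) - 2)) / (lam * E ^ 3))
    (C : Matrix (Fin R) (Fin R) ℝ)
    (hC : ∀ i j : Fin R, i ≠ j → C i j =
      κ * (2 : ℝ) ^ ((2 : ℤ) - ((i : ℕ) + 1 : ℤ) - ((j : ℕ) + 1 : ℤ)) *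
        (Nat.factorial (((i : ℕ) + 1) + ((j : ℕ) + 1) - 2) : ℝ) /
          ((Nat.factorial (i : ℕ) : ℝ) * (Nat.factorial (j : ℕ) : ℝ)) *
        kon * esymm (fun i => (k i) ^ 2) (Finset.Icc 1 G) (G : ℤ)) :
    ∀ i j : Fin R, i ≠ j →
      (1 < FFC G k kon koff R → 0 < C i j) ∧
      (FFC G k kon koff R < 1 → C i j < 0) := by
  intro i j hij
  have hE0 : 0 < E := by
    rw [hE]
    have h1 : 0 ≤ esymm k (Finset.Icc 2 G) ((G : ℤ) - 1) := by
      apply aux_esymm_nonneg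
      intro i hi
      apply hk
      simp only [Finset.mem_Icc] at hi ⊢
      omega
    have h2 : 0 < esymm k (Finset.Icc 1 G) ((G : ℤ) - 1) := by
      apply aux_esymm_pos _ _ _ (by omega) (by simp) hk
    positivity
  have he : 0 < esymm k (Finset.Icc 1 G) (G : ℤ) :=
    aux_esymm_pos _ _ _ (by omega) (by simp) hk
  have he2 : 0 < esymm (fun i => (k i) ^ 2) (Finset.Icc 1 G) (G : ℤ) :=
    aux_esymm_pos _ _ _ (by omega) (by simp) (fun i hi => pow_pos (hk i hi) 2)
  have hd : 0 < 1 - (dfact (2 * R - 1) : ℝ) / (dfact (2 * R) : ℝ) := by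
    have hp : (0 : ℝ) < (dfact (2 * R) : ℝ) := by exact_mod_cast aux_dfact_pos R
    have hl : (dfact (2 * R - 1) : ℝ) < (dfact (2 * R) : ℝ) := by
      obtain ⟨n, rfl⟩ : ∃ n, R = n + 1 := ⟨R - 1, by omega⟩
      exact_mod_cast aux_dfact_lt n
    rw [sub_pos, div_lt_one hp]
    exact hl
  rw [hC i j hij, hκ]
  unfold FFC
  rw [← hE]
  generalize (koff * esymm k (Finset.Icc 2 G) ((G : ℤ) - 1)
      - kon * koff * esymm k (Finset.Icc 2 G) ((G : ℤ) - 2)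
      - kon ^ 2 * esymm k (Finset.Icc 1 G) ((G : ℤ) - 2)) = N
  generalize esymm k (Finset.Icc 1 G) (G : ℤ) = a at *
  generalize esymm (fun i => (k i) ^ 2) (Finset.Icc 1 G) (G : ℤ) = b at *
  generalize 1 - (dfact (2 * R - 1) : ℝ) / (dfact (2 * R) : ℝ) = d at *
  have hq : 0 < (2 : ℝ) ^ ((2 : ℤ) - ((i : ℕ) + 1 : ℤ) - ((j : ℕ) + 1 : ℤ)) := by positivity
  generalize (2 : ℝ) ^ ((2 : ℤ) - ((i : ℕ) + 1 : ℤ) - ((j : ℕ) + 1 : ℤ)) = q at *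
  have hf := Nat.factorial_pos (((i : ℕ) + 1) + ((j : ℕ) + 1) - 2)
  generalize Nat.factorial (((i : ℕ) + 1) + ((j : ℕ) + 1) - 2) = f at *
  have e1 : 1 + 2 * a * d * N / E ^ 2 = 1 + (2 * a * d / E ^ 2) * N := by ring
  have e2 : N / (lam * E ^ 3) * q * (f : ℝ) /
      ((Nat.factorial (i : ℕ) : ℝ) * (Nat.factorial (j : ℕ) : ℝ)) * kon * b =
      (1 / (lam * E ^ 3) * q * (f : ℝ) /
      ((Nat.factorial (i : ℕ) : ℝ) * (Nat.factorial (j : ℕ) : ℝ)) * kon * b) * N := by ring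
  rw [e1, e2]
  have p1 : 0 < 2 * a * d / E ^ 2 := by positivity
  have p2 : 0 < 1 / (lam * E ^ 3) * q * (f : ℝ) /
      ((Nat.factorial (i : ℕ) : ℝ) * (Nat.factorial (j : ℕ) : ℝ)) * kon * b := by positivity
  constructor
  · intro h
    exact mul_pos p2 (pos_of_mul_pos_right (by linarith) p1.le)
  · intro h
    refine mul_neg_of_pos_of_neg p2 ?_
    by_contra hN
    have := mul_nonneg p1.le (not_lt.1 hN)
    linarith
end

section
/- Fix an integer G ≥ 2 and positive reals k_on, k_1, …, k_G, and a nonnegative real k_off. Then for every integer R ≥ 1: if FF^C(R, k_off) > 1 then FF^C(R+1, k_off) > FF^C(R, k_off); if FF^C(R, k_off) < 1 then FF^C(R+1, k_off) < FF^C(R, k_off); and if FF^C(R, k_off) = 1 then FF^C(R+1, k_off) = FF^C(R, k_off). In particular, R ↦ FF^C(R, k_off) is strictly increasing when the fluctuations are super-Poissonian and strictly decreasing when they are sub-Poissonian. -/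
theorem dfact_pos' (n : ℕ) : 0 < dfact n := by
  induction n using dfact.induct with
  | case1 => simp [dfact]
  | case2 => simp [dfact]
  | case3 n ih => rw [dfact]; positivity

theorem dfact_lt' (m : ℕ) : dfact (2 * m + 1) < dfact (2 * m + 2) := by
  induction m with
  | zero => simp [dfact]
  | succ m ih =>
    have h1 : dfact (2 * (m + 1) + 1) = (2 * m + 3) * dfact (2 * m + 1) := by
      rw [show 2 * (m + 1) + 1 = (2 * m + 1) + 2 by ring, dfact]
    have h2 : dfact (2 * (m + 1) + 2) = (2 * m + 4) * dfact (2 * m + 2) := by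
      rw [show 2 * (m + 1) + 2 = (2 * m + 2) + 2 by ring, dfact]
    rw [h1, h2]
    nlinarith

theorem ratio_facts (R : ℕ) (hR : 1 ≤ R) :
    0 < (1 - (dfact (2 * R - 1) : ℝ) / (dfact (2 * R) : ℝ)) ∧
    (1 - (dfact (2 * R - 1) : ℝ) / (dfact (2 * R) : ℝ)) <
      (1 - (dfact (2 * (R + 1) - 1) : ℝ) / (dfact (2 * (R + 1)) : ℝ)) := by
  obtain ⟨m, rfl⟩ : ∃ m, R = m + 1 := ⟨R - 1, by omega⟩
  rw [show 2 * (m + 1 + 1) - 1 = (2 * m + 1) + 2 by omega,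
    show 2 * (m + 1 + 1) = (2 * m + 2) + 2 by omega,
    show 2 * (m + 1) - 1 = 2 * m + 1 by omega,
    show 2 * (m + 1) = 2 * m + 2 by omega]
  have e1 : dfact (2 * m + 1 + 2) = (2 * m + 1 + 2) * dfact (2 * m + 1) := by rw [dfact]
  have e2 : dfact (2 * m + 2 + 2) = (2 * m + 2 + 2) * dfact (2 * m + 2) := by rw [dfact]
  rw [e1, e2]
  have ha : (0 : ℝ) < dfact (2 * m + 1) := by exact_mod_cast dfact_pos' _
  have hb : (0 : ℝ) < dfact (2 * m + 2) := by exact_mod_cast dfact_pos' _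
  have hab : (dfact (2 * m + 1) : ℝ) < dfact (2 * m + 2) := by exact_mod_cast dfact_lt' m
  push_cast
  generalize (dfact (2 * m + 1) : ℝ) = a at *
  generalize (dfact (2 * m + 2) : ℝ) = b at *
  constructor
  · rw [sub_pos, div_lt_one hb]; exact hab
  · apply sub_lt_sub_left
    rw [div_lt_div_iff₀ (by positivity) hb]
    nlinarith [mul_pos ha hb]

theorem FFC_form (G : ℕ) (k : ℕ → ℝ) (kon koff : ℝ) : ∃ C : ℝ, ∀ R : ℕ,
    FFC G k kon koff R = 1 + (1 - (dfact (2 * R - 1) : ℝ) / (dfact (2 * R) : ℝ)) * C := by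
  refine ⟨2 * esymm k (Finset.Icc 1 G) (G : ℤ) *
      (koff * esymm k (Finset.Icc 2 G) ((G : ℤ) - 1)
        - kon * koff * esymm k (Finset.Icc 2 G) ((G : ℤ) - 2)
        - kon ^ 2 * esymm k (Finset.Icc 1 G) ((G : ℤ) - 2)) /
      (koff * esymm k (Finset.Icc 2 G) ((G : ℤ) - 1)
        + kon * esymm k (Finset.Icc 1 G) ((G : ℤ) - 1)) ^ 2, fun R => ?_⟩
  unfold FFC
  ring

/-- the cytoplasmic Fano factor increases with the number of
processing steps `R` when super-Poissonian, decreases when sub-Poissonian,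
and is unchanged when equal to one. -/
theorem FFC_monotone_in_R
    (G : ℕ) (hG : 2 ≤ G)
    (kon koff : ℝ) (k : ℕ → ℝ)
    (hkon : 0 < kon) (hkoff : 0 ≤ koff)
    (hk : ∀ i ∈ Finset.Icc 1 G, 0 < k i) :
    ∀ R : ℕ, 1 ≤ R →
      (1 < FFC G k kon koff R → FFC G k kon koff R < FFC G k kon koff (R + 1)) ∧
      (FFC G k kon koff R < 1 → FFC G k kon koff (R + 1) < FFC G k kon koff R) ∧
      (FFC G k kon koff R = 1 → FFC G k kon koff (R + 1) = FFC G k kon koff R) := by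
  intro R hR
  obtain ⟨C, hC⟩ := FFC_form G k kon koff
  obtain ⟨h0, h1⟩ := ratio_facts R hR
  rw [hC R, hC (R + 1)]
  generalize (1 - (dfact (2 * R - 1) : ℝ) / (dfact (2 * R) : ℝ)) = a at *
  generalize (1 - (dfact (2 * (R + 1) - 1) : ℝ) / (dfact (2 * (R + 1)) : ℝ)) = b at *
  refine ⟨fun h => ?_, fun h => ?_, fun h => ?_⟩
  · have : 0 < C := pos_of_mul_pos_right (by linarith : 0 < a * C) h0.le
    nlinarith
  · have : C < 0 := by
      by_contra hc
      have := mul_nonneg h0.le (not_lt.mp hc)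
      linarith
    nlinarith
  · have : C = 0 := by
      have h2 : a * C = 0 := by linarith
      exact (mul_eq_zero.mp h2).resolve_left h0.ne'
    simp [this]
end

section
/- Fix an integer G ≥ 2 and positive reals k_on, k_1, …, k_G, λ, λ_1, and regard FF^P(k_off) as a function of k_off on [0, ∞). Define k_1^* = e_{G−1}(k_2,…,k_G) e_{G−2}(k_2,…,k_G)/e_{G−2}(k_2²,…,k_G²), k_on,1^* = e_{G−1}(k_2,…,k_G)/e_{G−2}(k_2,…,k_G), k_on,2^* = e_{G−1}(k_2,…,k_G) e_{G−1}(k_1,…,k_G)/(k_1 e_{G−2}(k_2²,…,k_G²) − e_{G−1}(k_2,…,k_G) e_{G−2}(k_2,…,k_G)), and k_off,1 = [k_on e_{G−1}(k_2,…,k_G) e_{G−1}(k_1,…,k_G) − k_on² k_1 e_{G−2}(k_2²,…,k_G²) + k_on² e_{G−1}(k_2,…,k_G) e_{G−2}(k_2,…,k_G)] / [e_{G−1}(k_2,…,k_G)(e_{G−1}(k_2,…,k_G) − k_on e_{G−2}(k_2,…,k_G))]. Then: (Case 1) if k_1 > k_1^* and k_on > k_on,2^*, then k_off,1 > 0, FF^P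 is strictly decreasing on [0, k_off,1] and strictly increasing on [k_off,1, ∞), FF^P(k_off) < 1 + λ_1/λ for all k_off ≥ 0, and FF^P(k_off) → 1 + λ_1/λ as k_off → ∞; (Case 2) if either (k_1 ≤ k_1^* and k_on ≥ k_on,1^*) or (k_1 > k_1^* and k_on,1^* ≤ k_on ≤ k_on,2^*), then FF^P is strictly increasing on [0, ∞), FF^P(k_off) < 1 + λ_1/λ for all k_off ≥ 0, and FF^P(k_off) → 1 + λ_1/λ as k_off → ∞; (Case 3) if k_on < k_on,1^*, then k_off,1 > 0, FF^P is strictly increasing on [0, k_off,1] and strictly decreasing on [k_off,1, ∞), and FF^P(k_off) → 1 + λ_1/λ as k_off → ∞ with FF^P(k_off) > 1 + λ_1/λ for all sufficiently large k_off. -/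
open Filter

/-- Fano factor of protein number fluctuations from the slow-scale linear
noise approximation; `lam` is the cytoplasmic mRNA degradation rate and
`lam1` the protein production rate. -/
noncomputable def FFP (G : ℕ) (k : ℕ → ℝ) (kon koff lam lam1 : ℝ) : ℝ :=
  1 + lam1 / (2 * lam) + lam1 / (2 * lam) *
      (esymm (fun i => (k i) ^ 2) (Finset.Icc 2 G) ((G : ℤ) - 1) *
          (koff ^ 2 + 2 * koff * (kon + k 1))
        + kon ^ 2 * esymm (fun i => (k i) ^ 2) (Finset.Icc 1 G) ((G : ℤ) - 1)) /
      (koff * esymm k (Finset.Icc 2 G) ((G : ℤ) - 1)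
        + kon * esymm k (Finset.Icc 1 G) ((G : ℤ) - 1)) ^ 2

theorem esymm_nat (x : ℕ → ℝ) (s : Finset ℕ) (g : ℤ) (n : ℕ) (h : g = n) :
    esymm x s g = ∑ t ∈ s.powersetCard n, ∏ i ∈ t, x i := by
  subst h; simp [esymm]

theorem esymm_pos' (x : ℕ → ℝ) (s : Finset ℕ) (n : ℕ) (hn : n ≤ s.card)
    (hx : ∀ i ∈ s, 0 < x i) : 0 < ∑ t ∈ s.powersetCard n, ∏ i ∈ t, x i := by
  apply Finset.sum_pos
  · intro t ht
    exact Finset.prod_pos fun i hi => hx i ((Finset.mem_powersetCard.1 ht).1 hi)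
  · exact Finset.powersetCard_nonempty.2 hn

theorem esymm_ins (x : ℕ → ℝ) (s : Finset ℕ) (n : ℕ) (a : ℕ) (ha : a ∉ s) :
    ∑ t ∈ (insert a s).powersetCard (n+1), ∏ i ∈ t, x i
      = ∑ t ∈ s.powersetCard (n+1), ∏ i ∈ t, x i
        + x a * ∑ t ∈ s.powersetCard n, ∏ i ∈ t, x i := by
  have hm : ∀ t ∈ s.powersetCard n, a ∉ t := fun t ht h =>
    ha ((Finset.mem_powersetCard.1 ht).1 h)
  rw [Finset.powersetCard_succ_insert ha, Finset.sum_union, Finset.sum_image, Finset.mul_sum]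
  · congr 1
    exact Finset.sum_congr rfl fun t ht => Finset.prod_insert (hm t ht)
  · intro t ht u hu h
    have h1 := congrArg (fun z => Finset.erase z a) h
    simpa [Finset.erase_insert (hm t ht), Finset.erase_insert (hm u hu)] using h1
  · rw [Finset.disjoint_left]
    intro t ht ht'
    obtain ⟨u, _, rfl⟩ := Finset.mem_image.1 ht'
    exact ha ((Finset.mem_powersetCard.1 ht).1 (Finset.mem_insert_self a u))

theorem esymm_facts (G : ℕ) (hG : 2 ≤ G) (k : ℕ → ℝ)
    (hk : ∀ i ∈ Finset.Icc 1 G, 0 < k i) :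
    0 < esymm k (Finset.Icc 2 G) ((G : ℤ) - 1) ∧
    0 < esymm k (Finset.Icc 2 G) ((G : ℤ) - 2) ∧
    0 < esymm (fun i => (k i) ^ 2) (Finset.Icc 2 G) ((G : ℤ) - 2) ∧
    esymm (fun i => (k i) ^ 2) (Finset.Icc 2 G) ((G : ℤ) - 2) ≤
      esymm k (Finset.Icc 2 G) ((G : ℤ) - 2) ^ 2 ∧
    esymm (fun i => (k i) ^ 2) (Finset.Icc 2 G) ((G : ℤ) - 1) =
      esymm k (Finset.Icc 2 G) ((G : ℤ) - 1) ^ 2 ∧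
    esymm k (Finset.Icc 1 G) ((G : ℤ) - 1) =
      esymm k (Finset.Icc 2 G) ((G : ℤ) - 1) + k 1 * esymm k (Finset.Icc 2 G) ((G : ℤ) - 2) ∧
    esymm (fun i => (k i) ^ 2) (Finset.Icc 1 G) ((G : ℤ) - 1) =
      esymm k (Finset.Icc 2 G) ((G : ℤ) - 1) ^ 2 +
        (k 1) ^ 2 * esymm (fun i => (k i) ^ 2) (Finset.Icc 2 G) ((G : ℤ) - 2) := by
  obtain ⟨n, rfl⟩ := Nat.exists_eq_add_of_le' hG
  have e1 : (((n + 2 : ℕ) : ℤ) - 1) = ((n + 1 : ℕ) : ℤ) := by push_cast; ring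
  have e2 : (((n + 2 : ℕ) : ℤ) - 2) = (n : ℤ) := by push_cast; ring
  have hi : Finset.Icc 1 (n + 2) = insert 1 (Finset.Icc 2 (n + 2)) := by
    ext i; simp only [Finset.mem_Icc, Finset.mem_insert]; omega
  have hc : (Finset.Icc 2 (n + 2)).card = n + 1 := by simp
  have hk' : ∀ i ∈ Finset.Icc 2 (n + 2), 0 < k i := fun i h => hk i (by
    rw [hi]; exact Finset.mem_insert_of_mem h)
  have hk2 : ∀ i ∈ Finset.Icc 2 (n + 2), 0 < (k i) ^ 2 := fun i h => pow_pos (hk' i h) 2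
  simp only [esymm_nat _ _ _ _ e1, esymm_nat _ _ _ _ e2]
  have hsq : ∑ t ∈ (Finset.Icc 2 (n + 2)).powersetCard (n + 1), ∏ i ∈ t, (k i) ^ 2
      = (∑ t ∈ (Finset.Icc 2 (n + 2)).powersetCard (n + 1), ∏ i ∈ t, k i) ^ 2 := by
    conv_lhs => rw [← hc, Finset.powersetCard_self]
    conv_rhs => rw [← hc, Finset.powersetCard_self]
    simp [Finset.prod_pow]
  refine ⟨esymm_pos' _ _ _ (by omega) hk', esymm_pos' _ _ _ (by omega) hk',
    esymm_pos' _ _ _ (by omega) hk2, ?_, hsq, ?_, ?_⟩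
  · simp only [Finset.prod_pow]
    have hn : ∀ t ∈ (Finset.Icc 2 (n + 2)).powersetCard n, 0 ≤ ∏ i ∈ t, k i := fun t ht =>
      Finset.prod_nonneg fun i hi => (hk' i ((Finset.mem_powersetCard.1 ht).1 hi)).le
    rw [sq (∑ t ∈ (Finset.Icc 2 (n + 2)).powersetCard n, ∏ i ∈ t, k i), Finset.sum_mul]
    apply Finset.sum_le_sum
    intro t ht
    rw [sq]
    exact mul_le_mul_of_nonneg_left
      (Finset.single_le_sum (f := fun t => ∏ i ∈ t, k i) hn ht) (hn t ht)
  · rw [hi]; exact esymm_ins _ _ _ _ (by simp)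
  · rw [← hsq, hi]; exact esymm_ins _ _ _ _ (by simp)

theorem core_diff (A B C a c x y L : ℝ)
    (hx : x * A + a * (A + c * B) ≠ 0) (hy : y * A + a * (A + c * B) ≠ 0) :
    (1 + L + L * (A ^ 2 * (y ^ 2 + 2 * y * (a + c)) + a ^ 2 * (A ^ 2 + c ^ 2 * C)) /
        (y * A + a * (A + c * B)) ^ 2) -
    (1 + L + L * (A ^ 2 * (x ^ 2 + 2 * x * (a + c)) + a ^ 2 * (A ^ 2 + c ^ 2 * C)) /
        (x * A + a * (A + c * B)) ^ 2) =
    L * (y - x) * c * A *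
      (((a * A * (A + c * B) - a ^ 2 * c * C + a ^ 2 * A * B) - x * (A * (A - a * B))) *
          (y * A + a * (A + c * B)) +
       ((a * A * (A + c * B) - a ^ 2 * c * C + a ^ 2 * A * B) - y * (A * (A - a * B))) *
          (x * A + a * (A + c * B))) /
      ((x * A + a * (A + c * B)) ^ 2 * (y * A + a * (A + c * B)) ^ 2) := by
  rw [add_sub_add_left_eq_sub, div_sub_div _ _ (pow_ne_zero 2 hy) (pow_ne_zero 2 hx)]
  congr 1 <;> ring

theorem core_lim_diff (A B C a c x L : ℝ)
    (hx : x * A + a * (A + c * B) ≠ 0) :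
    (1 + L + L * (A ^ 2 * (x ^ 2 + 2 * x * (a + c)) + a ^ 2 * (A ^ 2 + c ^ 2 * C)) /
        (x * A + a * (A + c * B)) ^ 2) - (1 + 2 * L) =
    L * (2 * x * A * c * (A - a * B) + a ^ 2 * (c ^ 2 * (C - B ^ 2) - 2 * c * A * B)) /
      (x * A + a * (A + c * B)) ^ 2 := by
  have h2 := pow_ne_zero 2 hx
  rw [eq_div_iff h2, sub_mul, add_mul, div_mul_cancel₀ _ h2]
  ring

theorem core_tendsto (A B C a c L : ℝ) (hA : 0 < A) :
    Filter.Tendsto (fun x : ℝ =>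
      1 + L + L * (A ^ 2 * (x ^ 2 + 2 * x * (a + c)) + a ^ 2 * (A ^ 2 + c ^ 2 * C)) /
        (x * A + a * (A + c * B)) ^ 2) Filter.atTop (nhds (1 + 2 * L)) := by
  have hi : Filter.Tendsto (fun x : ℝ => x⁻¹) Filter.atTop (nhds 0) := tendsto_inv_atTop_zero
  have h1 : Filter.Tendsto (fun x : ℝ =>
      1 + L + L * (A ^ 2 * (1 + 2 * x⁻¹ * (a + c)) + a ^ 2 * (A ^ 2 + c ^ 2 * C) * (x⁻¹) ^ 2) /
        (A + a * (A + c * B) * x⁻¹) ^ 2) Filter.atTop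
      (nhds (1 + L + L * (A ^ 2 * (1 + 2 * 0 * (a + c)) + a ^ 2 * (A ^ 2 + c ^ 2 * C) * 0 ^ 2) /
        (A + a * (A + c * B) * 0) ^ 2)) := by
    have hc : ContinuousAt (fun u : ℝ =>
      1 + L + L * (A ^ 2 * (1 + 2 * u * (a + c)) + a ^ 2 * (A ^ 2 + c ^ 2 * C) * u ^ 2) /
        (A + a * (A + c * B) * u) ^ 2) 0 := by
      apply ContinuousAt.add (by fun_prop)
      apply ContinuousAt.div (by fun_prop) (by fun_prop)
      simp [hA.ne']
    exact hc.tendsto.comp hi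
  have h2 : 1 + L + L * (A ^ 2 * (1 + 2 * 0 * (a + c)) + a ^ 2 * (A ^ 2 + c ^ 2 * C) * 0 ^ 2) /
        (A + a * (A + c * B) * 0) ^ 2 = 1 + 2 * L := by
    simp only [mul_zero, zero_mul, add_zero, mul_one, ne_eq, OfNat.ofNat_ne_zero, not_false_eq_true,
      zero_pow]
    rw [mul_div_cancel_right₀ _ (pow_ne_zero 2 hA.ne')]; ring
  rw [h2] at h1
  refine h1.congr' ?_
  filter_upwards [Filter.eventually_gt_atTop 0] with x hx
  congr 1
  have e : A + a * (A + c * B) * x⁻¹ = (x * A + a * (A + c * B)) * x⁻¹ := by field_simp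
  have e' : L * (A ^ 2 * (1 + 2 * x⁻¹ * (a + c)) + a ^ 2 * (A ^ 2 + c ^ 2 * C) * (x⁻¹) ^ 2)
    = L * (A ^ 2 * (x ^ 2 + 2 * x * (a + c)) + a ^ 2 * (A ^ 2 + c ^ 2 * C)) * (x⁻¹) ^ 2 := by
    field_simp
  rw [e, e', mul_pow, mul_div_mul_right]
  positivity

theorem core_main (A B C a c L P Q : ℝ) (f : ℝ → ℝ)
    (hA : 0 < A) (hB : 0 < B) (hC : 0 < C) (hCB : C ≤ B ^ 2) (ha : 0 < a) (hc : 0 < c)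
    (hL : 0 < L)
    (hf : f = fun x => 1 + L +
      L * (A ^ 2 * (x ^ 2 + 2 * x * (a + c)) + a ^ 2 * (A ^ 2 + c ^ 2 * C)) /
        (x * A + a * (A + c * B)) ^ 2)
    (hP : P = a * A * (A + c * B) - a ^ 2 * c * C + a ^ 2 * A * B)
    (hQ : Q = A * (A - a * B)) :
    ((A * B / C < c ∧ A * (A + c * B) / (c * C - A * B) < a) →
      0 < P / Q ∧ StrictAntiOn f (Set.Icc 0 (P / Q)) ∧ StrictMonoOn f (Set.Ici (P / Q)) ∧
      (∀ x : ℝ, 0 ≤ x → f x < 1 + 2 * L) ∧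
      Filter.Tendsto f Filter.atTop (nhds (1 + 2 * L))) ∧
    (((c ≤ A * B / C ∧ A / B ≤ a) ∨
        (A * B / C < c ∧ A / B ≤ a ∧ a ≤ A * (A + c * B) / (c * C - A * B))) →
      StrictMonoOn f (Set.Ici 0) ∧
      (∀ x : ℝ, 0 ≤ x → f x < 1 + 2 * L) ∧
      Filter.Tendsto f Filter.atTop (nhds (1 + 2 * L))) ∧
    (a < A / B →
      0 < P / Q ∧ StrictMonoOn f (Set.Icc 0 (P / Q)) ∧ StrictAntiOn f (Set.Ici (P / Q)) ∧
      Filter.Tendsto f Filter.atTop (nhds (1 + 2 * L)) ∧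
      (∀ᶠ x : ℝ in Filter.atTop, 1 + 2 * L < f x)) := by
  have hD : ∀ x : ℝ, 0 ≤ x → 0 < x * A + a * (A + c * B) := fun x hx => by positivity
  have hT : Filter.Tendsto f Filter.atTop (nhds (1 + 2 * L)) := by
    rw [hf]; exact core_tendsto A B C a c L hA
  have up : ∀ x y : ℝ, 0 ≤ x → x < y →
      0 < (P - x * Q) * (y * A + a * (A + c * B)) + (P - y * Q) * (x * A + a * (A + c * B)) →
      f x < f y := by
    intro x y hx hxy h
    have hy : 0 ≤ y := hx.trans hxy.le
    have d := core_diff A B C a c x y L (hD x hx).ne' (hD y hy).ne'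
    rw [← hP, ← hQ] at d
    have h1 := hD x hx
    have h2 := hD y hy
    have h3 := sub_pos.2 hxy
    have : 0 < f y - f x := by rw [hf]; simp only []; rw [d]; positivity
    linarith
  have down : ∀ x y : ℝ, 0 ≤ x → x < y →
      (P - x * Q) * (y * A + a * (A + c * B)) + (P - y * Q) * (x * A + a * (A + c * B)) < 0 →
      f y < f x := by
    intro x y hx hxy h
    have hy : 0 ≤ y := hx.trans hxy.le
    have d := core_diff A B C a c x y L (hD x hx).ne' (hD y hy).ne'
    rw [← hP, ← hQ] at d
    have h1 := hD x hx
    have h2 := hD y hy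
    have h3 := sub_pos.2 hxy
    have : f y - f x < 0 := by
      rw [hf]; simp only []; rw [d]
      apply div_neg_of_neg_of_pos _ (by positivity)
      exact mul_neg_of_pos_of_neg (by positivity) h
    linarith
  have bd : A ≤ a * B → ∀ x : ℝ, 0 ≤ x → f x < 1 + 2 * L := by
    intro h x hx
    have d := core_lim_diff A B C a c x L (hD x hx).ne'
    have h1 := hD x hx
    have : f x - (1 + 2 * L) < 0 := by
      rw [hf]; simp only []; rw [d]
      apply div_neg_of_neg_of_pos _ (by positivity)
      apply mul_neg_of_pos_of_neg hL
      have t1 : 0 ≤ 2 * x * A * c * (a * B - A) := mul_nonneg (by positivity) (by linarith)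
      have t2 : 0 ≤ a ^ 2 * (c ^ 2 * (B ^ 2 - C)) :=
        mul_nonneg (by positivity) (mul_nonneg (by positivity) (by linarith))
      have t3 : 0 < a ^ 2 * (2 * c * A * B) := by positivity
      linarith
    linarith
  have hPpos : a * B ≤ A → 0 < P := by
    intro h
    have t1 : 0 ≤ a ^ 2 * c * (B ^ 2 - C) := mul_nonneg (by positivity) (by linarith)
    have t2 : 0 ≤ a * c * B * (A - a * B) := mul_nonneg (by positivity) (by linarith)
    have t3 : 0 < a * A * A + a ^ 2 * A * B := by positivity
    rw [hP]; linarith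
  -- sign lemmas for the bracket around the critical point
  have key : ∀ z x y : ℝ, P = z * Q →
      (P - x * Q) * (y * A + a * (A + c * B)) + (P - y * Q) * (x * A + a * (A + c * B))
      = Q * ((z - x) * (y * A + a * (A + c * B)) + (z - y) * (x * A + a * (A + c * B))) := by
    intro z x y h; rw [h]; ring
  have left : ∀ z x y : ℝ, 0 ≤ x → x < y → y ≤ z →
      0 < (z - x) * (y * A + a * (A + c * B)) + (z - y) * (x * A + a * (A + c * B)) := by
    intro z x y hx hxy hyz
    have h1 : 0 < (z - x) * (y * A + a * (A + c * B)) :=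
      mul_pos (by linarith) (hD y (by linarith))
    have h2 : 0 ≤ (z - y) * (x * A + a * (A + c * B)) :=
      mul_nonneg (by linarith) (hD x hx).le
    linarith
  have right : ∀ z x y : ℝ, 0 ≤ x → z ≤ x → x < y →
      (z - x) * (y * A + a * (A + c * B)) + (z - y) * (x * A + a * (A + c * B)) < 0 := by
    intro z x y hx hzx hxy
    have h1 : 0 ≤ (x - z) * (y * A + a * (A + c * B)) :=
      mul_nonneg (by linarith) (hD y (by linarith)).le
    have h2 : 0 < (y - z) * (x * A + a * (A + c * B)) :=
      mul_pos (by linarith) (hD x hx)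
    linarith
  refine ⟨?_, ?_, ?_⟩
  · rintro ⟨h1, h2⟩
    rw [div_lt_iff₀ hC] at h1
    rw [div_lt_iff₀ (by linarith)] at h2
    have hPn : P < 0 := by
      have := mul_lt_mul_of_pos_left h2 ha
      rw [hP]; linarith
    have hAB : A < a * B := by
      by_contra hcon
      exact absurd (hPpos (not_lt.1 hcon)) (by linarith)
    have hQn : Q < 0 := by rw [hQ]; exact mul_neg_of_pos_of_neg hA (by linarith)
    have hz : P = P / Q * Q := (div_mul_cancel₀ P hQn.ne).symm
    have hzp : 0 < P / Q := div_pos_of_neg_of_neg hPn hQn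
    refine ⟨hzp, ?_, ?_, bd hAB.le, hT⟩
    · intro x hx y hy hxy
      apply down x y hx.1 hxy
      rw [key _ x y hz]
      exact mul_neg_of_neg_of_pos hQn (left _ x y hx.1 hxy hy.2)
    · intro x hx y hy hxy
      have hx0 : 0 ≤ x := hzp.le.trans hx
      apply up x y hx0 hxy
      rw [key _ x y hz]
      exact mul_pos_of_neg_of_neg hQn (right _ x y hx0 hx hxy)
  · intro h
    have hA2 : A ≤ a * B := by
      have : A / B ≤ a := by rcases h with h | h; exacts [h.2, h.2.1]
      rwa [div_le_iff₀ hB] at this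
    have hP0 : 0 ≤ P := by
      rcases h with ⟨h1, _⟩ | ⟨h1, _, h2⟩
      · rw [le_div_iff₀ hC] at h1
        have t1 : 0 ≤ a ^ 2 * (A * B - c * C) := mul_nonneg (by positivity) (by linarith)
        have t2 : 0 < a * A * (A + c * B) := by positivity
        rw [hP]; linarith
      · rw [div_lt_iff₀ hC] at h1
        rw [le_div_iff₀ (by linarith)] at h2
        have := mul_le_mul_of_nonneg_left h2 ha.le
        rw [hP]; linarith
    have hQ0 : Q ≤ 0 := by
      rw [hQ]; exact mul_nonpos_of_nonneg_of_nonpos hA.le (by linarith)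
    refine ⟨?_, bd hA2, hT⟩
    intro x hx y hy hxy
    have hx0 : 0 ≤ x := hx
    apply up x y hx0 hxy
    have hyp : 0 < y := by linarith
    have h1 : 0 ≤ P - x * Q := by nlinarith
    have h2 : 0 < P - y * Q := by
      rcases hA2.eq_or_lt with he | hl
      · have := hPpos he.ge
        nlinarith
      · have : Q < 0 := by rw [hQ]; exact mul_neg_of_pos_of_neg hA (by linarith)
        nlinarith
    have h3 := hD x hx0
    have h4 := hD y hyp.le
    positivity
  · intro h
    rw [lt_div_iff₀ hB] at h
    have hPp := hPpos h.le
    have hQp : 0 < Q := by rw [hQ]; exact mul_pos hA (by linarith)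
    have hz : P = P / Q * Q := (div_mul_cancel₀ P hQp.ne').symm
    have hzp : 0 < P / Q := div_pos hPp hQp
    refine ⟨hzp, ?_, ?_, hT, ?_⟩
    · intro x hx y hy hxy
      apply up x y hx.1 hxy
      rw [key _ x y hz]
      exact mul_pos hQp (left _ x y hx.1 hxy hy.2)
    · intro x hx y hy hxy
      have hx0 : 0 ≤ x := hzp.le.trans hx
      apply down x y hx0 hxy
      rw [key _ x y hz]
      exact mul_neg_of_pos_of_neg hQp (right _ x y hx0 hx hxy)
    · have hs : 0 < 2 * A * c * (A - a * B) := mul_pos (by positivity) (by linarith)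
      filter_upwards [Filter.eventually_gt_atTop 0, Filter.eventually_gt_atTop
        (-(a ^ 2 * (c ^ 2 * (C - B ^ 2) - 2 * c * A * B)) / (2 * A * c * (A - a * B)))]
        with x hx hx2
      rw [div_lt_iff₀ hs] at hx2
      have d := core_lim_diff A B C a c x L (hD x hx.le).ne'
      have h1 := hD x hx.le
      have : 0 < f x - (1 + 2 * L) := by
        rw [hf]; simp only []; rw [d]
        apply div_pos _ (by positivity)
        apply mul_pos hL
        linarith
      linarith

/-- the three types of behaviour of the protein Fano factor as
a function of the deactivation rate `koff`. -/
theorem FFP_three_cases_in_koff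
    (G : ℕ) (hG : 2 ≤ G)
    (kon lam lam1 : ℝ) (k : ℕ → ℝ)
    (hkon : 0 < kon) (hlam : 0 < lam) (hlam1 : 0 < lam1)
    (hk : ∀ i ∈ Finset.Icc 1 G, 0 < k i)
    (k1s kon1s kon2s koff1 : ℝ)
    (hk1s : k1s = esymm k (Finset.Icc 2 G) ((G : ℤ) - 1) *
      esymm k (Finset.Icc 2 G) ((G : ℤ) - 2) /
      esymm (fun i => (k i) ^ 2) (Finset.Icc 2 G) ((G : ℤ) - 2))
    (hkon1s : kon1s = esymm k (Finset.Icc 2 G) ((G : ℤ) - 1) /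
      esymm k (Finset.Icc 2 G) ((G : ℤ) - 2))
    (hkon2s : kon2s = esymm k (Finset.Icc 2 G) ((G : ℤ) - 1) *
      esymm k (Finset.Icc 1 G) ((G : ℤ) - 1) /
      (k 1 * esymm (fun i => (k i) ^ 2) (Finset.Icc 2 G) ((G : ℤ) - 2)
        - esymm k (Finset.Icc 2 G) ((G : ℤ) - 1) *
          esymm k (Finset.Icc 2 G) ((G : ℤ) - 2)))
    (hkoff1 : koff1 =
      (kon * esymm k (Finset.Icc 2 G) ((G : ℤ) - 1) *
          esymm k (Finset.Icc 1 G) ((G : ℤ) - 1)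
        - kon ^ 2 * k 1 * esymm (fun i => (k i) ^ 2) (Finset.Icc 2 G) ((G : ℤ) - 2)
        + kon ^ 2 * esymm k (Finset.Icc 2 G) ((G : ℤ) - 1) *
          esymm k (Finset.Icc 2 G) ((G : ℤ) - 2)) /
      (esymm k (Finset.Icc 2 G) ((G : ℤ) - 1) *
        (esymm k (Finset.Icc 2 G) ((G : ℤ) - 1)
          - kon * esymm k (Finset.Icc 2 G) ((G : ℤ) - 2)))) :
    -- Case 1
    ((k1s < k 1 ∧ kon2s < kon) →
      0 < koff1 ∧
      StrictAntiOn (fun koff => FFP G k kon koff lam lam1) (Set.Icc 0 koff1) ∧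
      StrictMonoOn (fun koff => FFP G k kon koff lam lam1) (Set.Ici koff1) ∧
      (∀ koff : ℝ, 0 ≤ koff → FFP G k kon koff lam lam1 < 1 + lam1 / lam) ∧
      Tendsto (fun koff => FFP G k kon koff lam lam1) atTop (nhds (1 + lam1 / lam))) ∧
    -- Case 2
    (((k 1 ≤ k1s ∧ kon1s ≤ kon) ∨ (k1s < k 1 ∧ kon1s ≤ kon ∧ kon ≤ kon2s)) →
      StrictMonoOn (fun koff => FFP G k kon koff lam lam1) (Set.Ici 0) ∧
      (∀ koff : ℝ, 0 ≤ koff → FFP G k kon koff lam lam1 < 1 + lam1 / lam) ∧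
      Tendsto (fun koff => FFP G k kon koff lam lam1) atTop (nhds (1 + lam1 / lam))) ∧
    -- Case 3
    (kon < kon1s →
      0 < koff1 ∧
      StrictMonoOn (fun koff => FFP G k kon koff lam lam1) (Set.Icc 0 koff1) ∧
      StrictAntiOn (fun koff => FFP G k kon koff lam lam1) (Set.Ici koff1) ∧
      Tendsto (fun koff => FFP G k kon koff lam lam1) atTop (nhds (1 + lam1 / lam)) ∧
      (∀ᶠ koff : ℝ in atTop, 1 + lam1 / lam < FFP G k kon koff lam lam1)) := by

  obtain ⟨hA, hB, hC, hCB, e1, e2, e3⟩ := esymm_facts G hG k hk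
  have h1 : 0 < k 1 := hk 1 (by simp; omega)
  have hf : (fun koff => FFP G k kon koff lam lam1) = fun koff => FFP G k kon koff lam lam1 := rfl
  conv_rhs at hf => simp only [FFP, e1, e2, e3]
  have hl : 1 + lam1 / lam = 1 + 2 * (lam1 / (2 * lam)) := by field_simp
  have main := core_main _ _ _ kon (k 1) (lam1 / (2 * lam)) _ _ _ hA hB hC hCB hkon h1
    (by positivity) hf rfl rfl
  rw [hl]
  rw [e2] at hkon2s hkoff1
  rw [hk1s, hkon1s, hkon2s, hkoff1]
  convert main using 6
end
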